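/- arXiv:2605.24741 — 5 statements merged into one kernel-verified Lean document; each statement's English description precedes it below -/
import Mathlib

section
/- Let X be a nonempty finite set, let p and q be distributions on X, and let ε ∈ (0,1). Suppose there exist clips c_L ∈ (0,1) and c_U ∈ (1,∞) satisfying the fixed-point equations ∑_{x∈X} max(p(x) − c_U·q(x), 0) = ε/(1+ε) and ∑_{x∈X} max(q(x) − p(x)/c_L, 0) = ε/(1+ε). Define L = {x : p(x) < c_L·q(x)}, H = {x : p(x) > c_U·q(x)}, M = X ∖ (L ∪ H), and define p*(x) = (1+ε)p(x) for x ∈ L ∪ M and p*(x) = c_U(1+ε)q(x) for x ∈ H, and q*(x) = ((1+ε)/c_L)·p(x) for x ∈ L and q*(x) = (1+ε)q(x) for x ∈ M ∪ H. Define the clipped likelihood ratio s : X → ℝ by s(x) = c_U if p(x) > c_U·q(x); s(x) = c_L if p(x) < c_L·q(x); s(x) = p(x)/q(x) if c_L·q(x) ≤ p(x) ≤ c_U·q(x) and q(x) > 0; and s(x) = 1 if p(x) = q(x) = 0. Then: (i) p* and q* are distributions on X with p* ∈ 𝒫_Sub(p,ε) and q* ∈ 𝒫_Sub(q,ε); (ii)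 for every distribution P on X with P(x) ≤ (1+ε)p(x) for all x and every t ∈ ℝ, ∑_{x : s(x) < t} P(x) ≤ ∑_{x : s(x) < t} p*(x) and ∑_{x : s(x) ≤ t} P(x) ≤ ∑_{x : s(x) ≤ t} p*(x); and (iii) for every distribution Q on X with Q(x) ≤ (1+ε)q(x) for all x and every t ∈ ℝ, ∑_{x : s(x) > t} Q(x) ≤ ∑_{x : s(x) > t} q*(x) and ∑_{x : s(x) ≥ t} Q(x) ≤ ∑_{x : s(x) ≥ t} q*(x). (This is the single-sample stochastic-domination property making (p*, q*) least favourable distributions for testing under ε-subtractive contamination.) -/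
open scoped Classical
open Finset

noncomputable section

/-- A probability distribution on a finite set. -/
def IsDist {X : Type*} [Fintype X] (p : X → ℝ) : Prop :=
  (∀ x, 0 ≤ p x) ∧ ∑ x, p x = 1

/-- ε-subtractive uncertainty set. -/
def PSub {X : Type*} [Fintype X] (p : X → ℝ) (ε : ℝ) : Set (X → ℝ) :=
  {p' | IsDist p' ∧ ∀ x, p' x ≤ (1 + ε) * p x}

/-- Two distributions compare on an event that is either certain or on which they compare
pointwise. -/
theorem IsDist.sum_filter_le {X : Type*} [Fintype X] {P P' : X → ℝ} (hP : IsDist P)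
    (hP' : IsDist P') (A : X → Prop) (h : (∀ x, A x) ∨ ∀ x, A x → P x ≤ P' x) :
    ∑ x ∈ univ.filter A, P x ≤ ∑ x ∈ univ.filter A, P' x := by
  rcases h with h | h
  · rw [filter_true_of_mem fun x _ => h x, hP.2, hP'.2]
  · exact sum_le_sum fun x hx => h x (mem_filter.1 hx).2

/-- Removing from `p` a nonnegative excess of total mass `ε / (1 + ε)` and rescaling by `1 + ε`
gives an element of the subtractive uncertainty set. -/
theorem mem_PSub_of_excess {X : Type*} [Fintype X] {p p' r : X → ℝ} {ε : ℝ} (hp : IsDist p)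
    (hε : 0 < ε) (hr : ∑ x, max (p x - r x) 0 = ε / (1 + ε)) (hr0 : ∀ x, 0 ≤ r x)
    (hp' : ∀ x, p' x = (1 + ε) * (p x - max (p x - r x) 0)) : p' ∈ PSub p ε := by
  have hε' : 0 < 1 + ε := by linarith
  refine ⟨⟨fun x => ?_, ?_⟩, fun x => ?_⟩
  · rw [hp']
    refine mul_nonneg hε'.le (sub_nonneg.2 (max_le ?_ (hp.1 x)))
    linarith [hr0 x]
  · simp_rw [hp']
    rw [← mul_sum, sum_sub_distrib, hp.2, hr]
    field_simp
    ring
  · rw [hp']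
    exact mul_le_mul_of_nonneg_left (sub_le_self _ (le_max_right _ _)) hε'.le

/-- LFDs for subtractive contamination: the explicit formulas define distributions in the
respective subtractive uncertainty sets, and the clipped likelihood ratio statistic is
stochastically dominated (from the appropriate side) by its law under the LFDs. -/
theorem subtractive_LFD_stochastic_domination
    {X : Type*} [Fintype X] [Nonempty X]
    (p q : X → ℝ) (hp : IsDist p) (hq : IsDist q)
    (ε : ℝ) (hε0 : 0 < ε) (hε1 : ε < 1)
    (cL cU : ℝ) (hcL0 : 0 < cL) (hcL1 : cL < 1) (hcU : 1 < cU)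
    (hfixU : ∑ x, max (p x - cU * q x) 0 = ε / (1 + ε))
    (hfixL : ∑ x, max (q x - p x / cL) 0 = ε / (1 + ε))
    (pstar qstar s : X → ℝ)
    (hpstar : ∀ x, pstar x =
      if p x > cU * q x then cU * (1 + ε) * q x else (1 + ε) * p x)
    (hqstar : ∀ x, qstar x =
      if p x < cL * q x then ((1 + ε) / cL) * p x else (1 + ε) * q x)
    (hs : ∀ x, s x =
      if p x > cU * q x then cU
      else if p x < cL * q x then cL
      else if 0 < q x then p x / q x
      else 1) :
    (pstar ∈ PSub p ε ∧ qstar ∈ PSub q ε) ∧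
    (∀ P : X → ℝ, IsDist P → (∀ x, P x ≤ (1 + ε) * p x) → ∀ t : ℝ,
      (∑ x ∈ univ.filter (fun x => s x < t), P x ≤
        ∑ x ∈ univ.filter (fun x => s x < t), pstar x) ∧
      (∑ x ∈ univ.filter (fun x => s x ≤ t), P x ≤
        ∑ x ∈ univ.filter (fun x => s x ≤ t), pstar x)) ∧
    (∀ Q : X → ℝ, IsDist Q → (∀ x, Q x ≤ (1 + ε) * q x) → ∀ t : ℝ,
      (∑ x ∈ univ.filter (fun x => t < s x), Q x ≤
        ∑ x ∈ univ.filter (fun x => t < s x), qstar x) ∧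
      (∑ x ∈ univ.filter (fun x => t ≤ s x), Q x ≤
        ∑ x ∈ univ.filter (fun x => t ≤ s x), qstar x)) := by
  have hpm : pstar ∈ PSub p ε := by
    refine mem_PSub_of_excess hp hε0 hfixU
      (fun x => mul_nonneg (by linarith) (hq.1 x)) fun x => ?_
    rw [hpstar]
    split_ifs with h
    · rw [max_eq_left (by linarith)]
      ring
    · rw [max_eq_right (by linarith)]
      ring
  have hqm : qstar ∈ PSub q ε := by
    refine mem_PSub_of_excess hq hε0 hfixL (fun x => div_nonneg (hp.1 x) hcL0.le) fun x => ?_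
    rw [hqstar]
    split_ifs with h
    · have : p x / cL < q x := (div_lt_iff₀' hcL0).2 h
      rw [max_eq_left (by linarith)]
      ring
    · have : q x ≤ p x / cL := (le_div_iff₀' hcL0).2 (not_lt.1 h)
      rw [max_eq_right (by linarith)]
      ring
  have hsU : ∀ x, s x ≤ cU := by
    intro x
    rw [hs]
    split_ifs with h₁ h₂ h₃
    · exact le_rfl
    · linarith
    · exact (div_le_iff₀ h₃).2 (not_lt.1 h₁)
    · exact hcU.le
  have hsL : ∀ x, cL ≤ s x := by
    intro x
    rw [hs]
    split_ifs with h₁ h₂ h₃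
    · linarith
    · exact le_rfl
    · exact (le_div_iff₀ h₃).2 (not_lt.1 h₂)
    · exact hcL1.le
  have hpU : ∀ x, s x < cU → pstar x = (1 + ε) * p x := by
    intro x hx
    rw [hpstar, if_neg]
    intro h
    rw [hs, if_pos h] at hx
    exact lt_irrefl _ hx
  have hqL : ∀ x, cL < s x → qstar x = (1 + ε) * q x := by
    intro x hx
    rw [hqstar, if_neg]
    intro h
    have h' : ¬ p x > cU * q x := by
      have : cL * q x ≤ cU * q x := mul_le_mul_of_nonneg_right (by linarith) (hq.1 x)
      linarith
    rw [hs, if_neg h', if_pos h] at hx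
    exact lt_irrefl _ hx
  refine ⟨⟨hpm, hqm⟩, fun P hP hPp t => ⟨?_, ?_⟩, fun Q hQ hQq t => ⟨?_, ?_⟩⟩
  · refine hP.sum_filter_le hpm.1 _ ((lt_or_ge cU t).imp (fun h x => (hsU x).trans_lt h) ?_)
    exact fun h x hx => (hPp x).trans_eq (hpU x (lt_of_lt_of_le hx h)).symm
  · refine hP.sum_filter_le hpm.1 _ ((le_or_gt cU t).imp (fun h x => (hsU x).trans h) ?_)
    exact fun h x hx => (hPp x).trans_eq (hpU x (lt_of_le_of_lt hx h)).symm
  · refine hQ.sum_filter_le hqm.1 _ ((lt_or_ge t cL).imp (fun h x => h.trans_le (hsL x)) ?_)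
    exact fun h x hx => (hQq x).trans_eq (hqL x (lt_of_le_of_lt h hx)).symm
  · refine hQ.sum_filter_le hqm.1 _ ((le_or_gt t cL).imp (fun h x => h.trans (hsL x)) ?_)
    exact fun h x hx => (hQq x).trans_eq (hqL x (lt_of_lt_of_le h hx)).symm

end
end

section
/- Let p and q be distributions on a nonempty finite set X, let ε ∈ (0,1), and suppose d_TV(p,q) > ε/(1+ε). Define F : [1,∞) → ℝ by F(c) = ∑_{x∈X} max(p(x) − c·q(x), 0). Then F is continuous and nonincreasing, F(1) = d_TV(p,q), F(c) ≥ p({x : q(x) = 0}) for all c ≥ 1 with F(c) → p({x : q(x) = 0}) as c → ∞, and there exists c_U ≥ 1 with F(c_U) = ε/(1+ε) if and only if p({x : q(x) = 0}) ≤ ε/(1+ε). Symmetrically, defining G : (0,1] → ℝ by G(c) = ∑_{x∈X} max(q(x) − p(x)/c, 0), there exists c_L ∈ (0,1] with G(c_L) = ε/(1+ε) if and only if q({x : p(x) = 0}) ≤ ε/(1+ε). -/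
open scoped Classical
open Finset

noncomputable section

/-- Total variation distance. -/
def dTV {X : Type*} [Fintype X] (p q : X → ℝ) : ℝ :=
  (1 / 2) * ∑ x, |p x - q x|

/-- The mass of `p` in excess of `c • q`. -/
def excess {X : Type*} [Fintype X] (p q : X → ℝ) (c : ℝ) : ℝ :=
  ∑ x, max (p x - c * q x) 0

section Excess

variable {X : Type*} [Fintype X] {p q : X → ℝ}

theorem dTV_comm (p q : X → ℝ) : dTV p q = dTV q p := by
  simp only [dTV, abs_sub_comm]

theorem continuous_excess (p q : X → ℝ) : Continuous (excess p q) := by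
  unfold excess
  fun_prop

theorem antitone_excess (p : X → ℝ) (hq : ∀ x, 0 ≤ q x) : Antitone (excess p q) := by
  intro a b hab
  refine Finset.sum_le_sum fun x _ => max_le_max ?_ le_rfl
  have := mul_le_mul_of_nonneg_right hab (hq x)
  linarith

theorem excess_one (h : ∑ x, p x = ∑ x, q x) : excess p q 1 = dTV p q := by
  have key : ∀ x, max (p x - 1 * q x) 0 = (1 / 2) * (|p x - q x| + (p x - q x)) := by
    intro x
    rcases le_total (p x - q x) 0 with hx | hx
    · rw [one_mul, max_eq_right hx, abs_of_nonpos hx]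
      ring
    · rw [one_mul, max_eq_left hx, abs_of_nonneg hx]
      ring
  simp only [excess, dTV, key, ← Finset.mul_sum, Finset.sum_add_distrib,
    Finset.sum_sub_distrib, h, sub_self, add_zero]

theorem mass_le_excess (p q : X → ℝ) (c : ℝ) :
    ∑ x ∈ univ.filter (fun x => q x = 0), p x ≤ excess p q c := by
  rw [Finset.sum_filter]
  refine Finset.sum_le_sum fun x _ => ?_
  split_ifs with hx
  · simp [hx]
  · exact le_max_right _ _

theorem exists_forall_excess_eq_mass (hp : ∀ x, 0 ≤ p x) (hq : ∀ x, 0 ≤ q x) :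
    ∃ C : ℝ, 1 ≤ C ∧ ∀ c, C ≤ c →
      excess p q c = ∑ x ∈ univ.filter (fun x => q x = 0), p x := by
  have hnn : ∀ x ∈ (univ : Finset X), 0 ≤ p x / q x := fun x _ => div_nonneg (hp x) (hq x)
  refine ⟨1 + ∑ x, p x / q x, by linarith [Finset.sum_nonneg hnn], fun c hc => ?_⟩
  rw [Finset.sum_filter]
  refine Finset.sum_congr rfl fun x _ => ?_
  split_ifs with hx
  · simp [hx, hp x]
  · have hpos : 0 < q x := lt_of_le_of_ne (hq x) (Ne.symm hx)
    have hle : p x / q x ≤ c := by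
      linarith [Finset.single_le_sum hnn (Finset.mem_univ x)]
    rw [div_le_iff₀ hpos] at hle
    exact max_eq_right (by linarith)

theorem exists_excess_eq_iff (hp : IsDist p) (hq : IsDist q) {t : ℝ} (ht : t < dTV p q) :
    (∃ c : ℝ, 1 ≤ c ∧ excess p q c = t) ↔
      ∑ x ∈ univ.filter (fun x => q x = 0), p x ≤ t := by
  constructor
  · rintro ⟨c, -, rfl⟩
    exact mass_le_excess p q c
  · intro h
    obtain ⟨C, hC, hmass⟩ := exists_forall_excess_eq_mass hp.1 hq.1
    rw [← excess_one (hp.2.trans hq.2.symm)] at ht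
    obtain ⟨c, hc, hct⟩ := intermediate_value_Icc' hC (continuous_excess p q).continuousOn
      ⟨(hmass C le_rfl).trans_le h, ht.le⟩
    exact ⟨c, hc.1, hct⟩

end Excess

/-- Existence of the subtractive clips: properties of the fixed-point functions `F` and `G`. -/
theorem subtractive_clip_existence
    {X : Type*} [Fintype X] [Nonempty X]
    (p q : X → ℝ) (hp : IsDist p) (hq : IsDist q)
    (ε : ℝ) (hε0 : 0 < ε) (hε1 : ε < 1)
    (hsep : ε / (1 + ε) < dTV p q)
    (F G : ℝ → ℝ)
    (hF : ∀ c, F c = ∑ x, max (p x - c * q x) 0)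
    (hG : ∀ c, G c = ∑ x, max (q x - p x / c) 0) :
    ContinuousOn F (Set.Ici (1 : ℝ)) ∧
    AntitoneOn F (Set.Ici (1 : ℝ)) ∧
    F 1 = dTV p q ∧
    (∀ c : ℝ, 1 ≤ c → ∑ x ∈ univ.filter (fun x => q x = 0), p x ≤ F c) ∧
    Filter.Tendsto F Filter.atTop
      (nhds (∑ x ∈ univ.filter (fun x => q x = 0), p x)) ∧
    ((∃ cU : ℝ, 1 ≤ cU ∧ F cU = ε / (1 + ε)) ↔
      ∑ x ∈ univ.filter (fun x => q x = 0), p x ≤ ε / (1 + ε)) ∧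
    ((∃ cL : ℝ, 0 < cL ∧ cL ≤ 1 ∧ G cL = ε / (1 + ε)) ↔
      ∑ x ∈ univ.filter (fun x => p x = 0), q x ≤ ε / (1 + ε)) := by
  obtain rfl : F = excess p q := funext hF
  obtain ⟨C, -, hmass⟩ := exists_forall_excess_eq_mass hp.1 hq.1
  refine ⟨(continuous_excess p q).continuousOn, (antitone_excess p hq.1).antitoneOn _,
    excess_one (hp.2.trans hq.2.symm), fun c _ => mass_le_excess p q c,
    tendsto_const_nhds.congr' ?_, exists_excess_eq_iff hp hq hsep, ?_⟩
  · filter_upwards [Filter.eventually_ge_atTop C] with c hc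
    exact (hmass c hc).symm
  · have hG' : ∀ c, G c = excess q p c⁻¹ := fun c => by
      simp only [hG, excess, div_eq_inv_mul]
    rw [← exists_excess_eq_iff hq hp (hsep.trans_eq (dTV_comm p q))]
    constructor
    · rintro ⟨c, hc0, hc1, hc⟩
      exact ⟨c⁻¹, (one_le_inv₀ hc0).2 hc1, (hG' c).symm.trans hc⟩
    · rintro ⟨c, hc1, hc⟩
      exact ⟨c⁻¹, inv_pos.2 (by linarith), inv_le_one_of_one_le₀ hc1, by
        rw [hG', inv_inv, hc]⟩

end
end

section
/- Consider X = {1,2,3} and, for ε > 0, the distributions p = (1/2 − 10ε, 1/2 + 8ε, 2ε) and q = (1/2, 1/2, 0), so that d_TV(p,q) = 10ε. (i) For every t with 0 < t < 1/2 there exist constants c(t), C(t), ε₀(t) > 0 such that for all ε ∈ (0, ε₀(t)), setting ε₂ = ε and ε₁ = ε − ε^{1+t}, one has 0 < ε₁ < ε₂ ≤ d_TV(p,q)/4, and c(t)/ε² ≤ n*_TV(p,q,ε₂) ≤ C(t)/ε² while c(t)/ε^{1+2t} ≤ n*_TV(p,q,ε₁) ≤ C(t)/ε^{1+2t}. (ii)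 For every t with 0 < t < 1/2 there exist such constants so that, setting ε₂ = 2ε/(1+2ε) and ε₁ = ε₂ − ε^{1+t}, one has 0 < ε₁ < ε₂ ≤ d_TV(p,q)/4, and c(t)/ε² ≤ n*_Hub(p,q,ε₂) ≤ C(t)/ε² while c(t)/ε^{1+2t} ≤ n*_Hub(p,q,ε₁) ≤ C(t)/ε^{1+2t}. (iii) For every t with 0 < t < 1 there exist such constants so that, setting ε₂ = 2ε/(1−2ε) and ε₁ = ε₂ − ε^{1+t}, one has 0 < ε₁ < ε₂ ≤ d_TV(p,q)/4, and c(t)/ε² ≤ n*_Sub(p,q,ε₂) ≤ C(t)/ε² while c(t)/ε^{1+t} ≤ n*_Sub(p,q,ε₁) ≤ C(t)/ε^{1+t}. -/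
open scoped Classical ENNReal
open Finset

noncomputable section

/-- Squared Hellinger divergence (also for unnormalized nonnegative vectors). -/
def hellSq {X : Type*} [Fintype X] (p q : X → ℝ) : ℝ :=
  ∑ x, (Real.sqrt (p x) - Real.sqrt (q x)) ^ 2

/-- ε-Huber uncertainty set. -/
def PHub {X : Type*} [Fintype X] (p : X → ℝ) (ε : ℝ) : Set (X → ℝ) :=
  {p' | IsDist p' ∧ ∀ x, (1 - ε) * p x ≤ p' x}

/-- ε-TV uncertainty set. -/
def PTV {X : Type*} [Fintype X] (p : X → ℝ) (ε : ℝ) : Set (X → ℝ) :=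
  {p' | IsDist p' ∧ dTV p' p ≤ ε}

/-- Sum of worst-case type-I and type-II errors of a randomized test `φ` on `n`
i.i.d. samples, for composite hypotheses `Pcal` vs `Qcal`. -/
def errSum {X : Type*} [Fintype X] (Pcal Qcal : Set (X → ℝ)) (n : ℕ)
    (φ : (Fin n → X) → ℝ) : ℝ :=
  (⨆ P : Pcal, ∑ x : Fin n → X, (∏ i, (P : X → ℝ) (x i)) * φ x) +
  (⨆ Q : Qcal, ∑ x : Fin n → X, (∏ i, (Q : X → ℝ) (x i)) * (1 - φ x))

/-- Minimax `n`-sample error for testing `Pcal` against `Qcal`. -/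
def eStar {X : Type*} [Fintype X] (Pcal Qcal : Set (X → ℝ)) (n : ℕ) : ℝ :=
  ⨅ φ : {φ : (Fin n → X) → ℝ // ∀ x, 0 ≤ φ x ∧ φ x ≤ 1}, errSum Pcal Qcal n φ.1

/-- Sample complexity: the least `n` with minimax error at most `1/10` (`⊤` if none). -/
def nStar {X : Type*} [Fintype X] (Pcal Qcal : Set (X → ℝ)) : ℝ≥0∞ :=
  sInf {N : ℝ≥0∞ | ∃ n : ℕ, N = (n : ℝ≥0∞) ∧ eStar Pcal Qcal n ≤ 1 / 10}

/-- The three-point example `p = (1/2 − 10ε, 1/2 + 8ε, 2ε)`. -/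
def pEx (ε : ℝ) : Fin 3 → ℝ := ![1 / 2 - 10 * ε, 1 / 2 + 8 * ε, 2 * ε]

/-- The three-point example `q = (1/2, 1/2, 0)`. -/
def qEx : Fin 3 → ℝ := ![1 / 2, 1 / 2, 0]

section ProductSums

variable {X : Type*} [Fintype X]

lemma sum_prod_apply_eq_pow (f : X → ℝ) (n : ℕ) :
    ∑ x : Fin n → X, ∏ i, f (x i) = (∑ x, f x) ^ n := by
  rw [← Fin.prod_const, Finset.prod_univ_sum]
  simp

lemma IsDist.sum_prod_eq_one {P : X → ℝ} (hP : IsDist P) (n : ℕ) :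
    ∑ x : Fin n → X, ∏ i, P (x i) = 1 := by
  rw [sum_prod_apply_eq_pow, hP.2, one_pow]

lemma IsDist.prod_nonneg {P : X → ℝ} (hP : IsDist P) {n : ℕ} (x : Fin n → X) :
    0 ≤ ∏ i, P (x i) :=
  Finset.prod_nonneg fun _ _ => hP.1 _

lemma sum_fin_succ_fun (n : ℕ) (g : (Fin (n + 1) → X) → ℝ) :
    ∑ x, g x = ∑ a : X, ∑ x : Fin n → X, g (Fin.cons a x) := by
  rw [← Fintype.sum_prod_type']
  exact (Fintype.sum_equiv (Fin.consEquiv fun _ => X) _ _ fun _ => rfl).symm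

/-- A sum of `n` i.i.d. centered variables is centered. -/
lemma IsDist.mean_sum_eq_zero {P : X → ℝ} (hP : IsDist P) {f : X → ℝ}
    (hf : ∑ a, P a * f a = 0) (n : ℕ) :
    ∑ x : Fin n → X, (∏ i, P (x i)) * ∑ i, f (x i) = 0 := by
  induction n with
  | zero => simp
  | succ n ih =>
    rw [sum_fin_succ_fun]
    have h (a : X) : ∑ x : Fin n → X, (∏ i, P ((Fin.cons a x : Fin (n + 1) → X) i)) *
        ∑ i, f ((Fin.cons a x : Fin (n + 1) → X) i) = P a * f a := by
      simp only [Fin.prod_univ_succ, Fin.sum_univ_succ, Fin.cons_zero, Fin.cons_succ]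
      calc _ = P a * f a * ∑ x : Fin n → X, ∏ i, P (x i) +
            P a * ∑ x : Fin n → X, (∏ i, P (x i)) * ∑ i, f (x i) := by
              rw [Finset.mul_sum, Finset.mul_sum, ← Finset.sum_add_distrib]
              exact Finset.sum_congr rfl fun x _ => by ring
        _ = _ := by rw [ih, hP.sum_prod_eq_one]; ring
    simp only [h, hf]

/-- The variance of a sum of `n` i.i.d. centered variables. -/
lemma IsDist.variance_sum {P : X → ℝ} (hP : IsDist P) {f : X → ℝ}
    (hf : ∑ a, P a * f a = 0) (n : ℕ) :
    ∑ x : Fin n → X, (∏ i, P (x i)) * (∑ i, f (x i)) ^ 2 = n * ∑ a, P a * f a ^ 2 := by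
  induction n with
  | zero => simp
  | succ n ih =>
    rw [sum_fin_succ_fun]
    have h (a : X) : ∑ x : Fin n → X, (∏ i, P ((Fin.cons a x : Fin (n + 1) → X) i)) *
        (∑ i, f ((Fin.cons a x : Fin (n + 1) → X) i)) ^ 2 =
          P a * f a ^ 2 + P a * (n * ∑ a, P a * f a ^ 2) := by
      simp only [Fin.prod_univ_succ, Fin.sum_univ_succ, Fin.cons_zero, Fin.cons_succ]
      calc _ = P a * f a ^ 2 * ∑ x : Fin n → X, ∏ i, P (x i) +
            2 * P a * f a * ∑ x : Fin n → X, (∏ i, P (x i)) * ∑ i, f (x i) +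
            P a * ∑ x : Fin n → X, (∏ i, P (x i)) * (∑ i, f (x i)) ^ 2 := by
              rw [Finset.mul_sum, Finset.mul_sum, Finset.mul_sum, ← Finset.sum_add_distrib,
                ← Finset.sum_add_distrib]
              exact Finset.sum_congr rfl fun x _ => by ring
        _ = _ := by rw [ih, hP.mean_sum_eq_zero hf, hP.sum_prod_eq_one]; ring
    simp only [h]
    rw [Finset.sum_add_distrib, ← Finset.sum_mul, hP.2]
    push_cast
    ring

/-- Chebyshev's inequality for the number of samples that fall in `A`: a bound on the mass of a
function `ψ ≤ 1` that is positive only where this number is at least `n * r` away from its mean. -/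
lemma IsDist.chebyshev {P : X → ℝ} (hP : IsDist P) (A : Finset X) {n : ℕ} {r : ℝ} (hr : 0 < r)
    (hn : 0 < n) (hnr : 20 * ∑ a ∈ A, P a ≤ n * r ^ 2) {ψ : (Fin n → X) → ℝ} (hψ1 : ∀ x, ψ x ≤ 1)
    (hψ : ∀ x, 0 < ψ x →
      n * r ≤ |(∑ i, if x i ∈ A then (1 : ℝ) else 0) - n * ∑ a ∈ A, P a|) :
    ∑ x : Fin n → X, (∏ i, P (x i)) * ψ x ≤ 1 / 20 := by
  set m := ∑ a ∈ A, P a with hm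
  have hind : ∑ a, P a * (if a ∈ A then (1 : ℝ) else 0) = m := by simp [hm]
  have hmean : ∑ a, P a * ((if a ∈ A then (1 : ℝ) else 0) - m) = 0 := by
    simp only [mul_sub, Finset.sum_sub_distrib, hind, ← Finset.sum_mul, hP.2]
    ring
  have hvar : ∑ a, P a * ((if a ∈ A then (1 : ℝ) else 0) - m) ^ 2 ≤ m := by
    have h (a : X) : P a * ((if a ∈ A then (1 : ℝ) else 0) - m) ^ 2 =
        (1 - 2 * m) * (P a * (if a ∈ A then (1 : ℝ) else 0)) + m ^ 2 * P a := by
      split_ifs <;> ring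
    simp only [h, Finset.sum_add_distrib, ← Finset.mul_sum, hind, hP.2]
    nlinarith [sq_nonneg m]
  have hn' : (0 : ℝ) < n := by exact_mod_cast hn
  have hpt (x : Fin n → X) : (∏ i, P (x i)) * ψ x ≤ ((n : ℝ) * r) ⁻¹ ^ 2 *
      ((∏ i, P (x i)) * (∑ i, ((if x i ∈ A then (1 : ℝ) else 0) - m)) ^ 2) := by
    have hS : ∑ i, ((if x i ∈ A then (1 : ℝ) else 0) - m) =
        (∑ i, if x i ∈ A then (1 : ℝ) else 0) - n * m := by
      simp [Finset.sum_sub_distrib]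
    rw [hS, mul_left_comm]
    refine mul_le_mul_of_nonneg_left ?_ (hP.prod_nonneg x)
    rcases le_or_gt (ψ x) 0 with h | h
    · exact h.trans (by positivity)
    · refine (hψ1 x).trans ?_
      have h2 := pow_le_pow_left₀ (by positivity) (hψ x h) 2
      rw [sq_abs] at h2
      rw [inv_pow, inv_mul_eq_div, le_div_iff₀ (by positivity), one_mul]
      exact h2
  refine (Finset.sum_le_sum fun x _ => hpt x).trans ?_
  rw [← Finset.mul_sum, hP.variance_sum hmean, inv_pow, inv_mul_eq_div, div_le_iff₀ (by positivity)]
  nlinarith [mul_le_mul_of_nonneg_left hvar hn'.le, mul_le_mul_of_nonneg_left hnr hn'.le]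

/-- Bhattacharyya bound on the overlap of two product distributions. -/
lemma pow_le_two_mul_sum_min {P Q : X → ℝ} (hP : IsDist P) (hQ : IsDist Q) (n : ℕ) :
    (∑ x, √(P x * Q x)) ^ (2 * n) ≤
      2 * ∑ x : Fin n → X, min (∏ i, P (x i)) (∏ i, Q (x i)) := by
  have hmin (x : Fin n → X) : 0 ≤ min (∏ i, P (x i)) (∏ i, Q (x i)) :=
    le_min (hP.prod_nonneg x) (hQ.prod_nonneg x)
  have hmax (x : Fin n → X) : 0 ≤ max (∏ i, P (x i)) (∏ i, Q (x i)) :=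
    le_max_of_le_left (hP.prod_nonneg x)
  have hs (x : Fin n → X) : ∏ i, √(P (x i) * Q (x i)) =
      √(min (∏ i, P (x i)) (∏ i, Q (x i))) * √(max (∏ i, P (x i)) (∏ i, Q (x i))) := by
    rw [← Real.sqrt_mul (hmin x), min_mul_max, ← Finset.prod_mul_distrib,
      Real.sqrt_prod]
    exact fun i _ => mul_nonneg (hP.1 _) (hQ.1 _)
  rw [mul_comm 2 n, pow_mul, ← sum_prod_apply_eq_pow]
  simp only [hs]
  refine (Finset.sum_mul_sq_le_sq_mul_sq _ _ _).trans ?_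
  simp only [Real.sq_sqrt (hmin _), Real.sq_sqrt (hmax _)]
  rw [mul_comm]
  refine mul_le_mul_of_nonneg_right ?_ (Finset.sum_nonneg fun x _ => hmin x)
  calc _ ≤ ∑ x : Fin n → X, (∏ i, P (x i) + ∏ i, Q (x i)) :=
        Finset.sum_le_sum fun x _ => max_le_add_of_nonneg (hP.prod_nonneg x) (hQ.prod_nonneg x)
    _ = 2 := by
        rw [Finset.sum_add_distrib, hP.sum_prod_eq_one, hQ.sum_prod_eq_one]; norm_num

lemma half_add_sub_le_sqrt_mul {a b : ℝ} (ha : 0 ≤ a) (hb : 0 ≤ b) :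
    (a + b) / 2 - (a - b) ^ 2 / (a + b) / 2 ≤ √(a * b) := by
  rcases (add_nonneg ha hb).eq_or_lt with h | h
  · simp [← h]
  · have hs : (√a - √b) ^ 2 ≤ (a - b) ^ 2 / (a + b) := by
      rw [le_div_iff₀ h]
      nlinarith [Real.sq_sqrt ha, Real.sq_sqrt hb, mul_nonneg (Real.sqrt_nonneg a)
        (Real.sqrt_nonneg b), mul_nonneg (mul_nonneg (Real.sqrt_nonneg a)
        (Real.sqrt_nonneg b)) (sq_nonneg (√a - √b))]
    rw [Real.sqrt_mul ha]
    nlinarith [Real.sq_sqrt ha, Real.sq_sqrt hb]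

end ProductSums

section SampleComplexity

variable {X : Type*} [Fintype X]

/-- If the hypotheses contain two distributions at small triangular discrimination, then many
samples are needed. -/
lemma ofReal_le_nStar {Pcal Qcal : Set (X → ℝ)} (hPcal : ∀ P ∈ Pcal, IsDist P)
    (hQcal : ∀ Q ∈ Qcal, IsDist Q) {P Q : X → ℝ} (hP : P ∈ Pcal) (hQ : Q ∈ Qcal) {h : ℝ}
    (hh : 0 < h) (hPQ : ∑ x, (P x - Q x) ^ 2 / (P x + Q x) ≤ 2 * h) :
    ENNReal.ofReal (2 / 5 / h) ≤ nStar Pcal Qcal := by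
  have dP := hPcal P hP
  have dQ := hQcal Q hQ
  have hBC : 1 - h ≤ ∑ x, √(P x * Q x) := by
    have := Finset.sum_le_sum fun x (_ : x ∈ Finset.univ) =>
      half_add_sub_le_sqrt_mul (dP.1 x) (dQ.1 x)
    rw [Finset.sum_sub_distrib, ← Finset.sum_div, ← Finset.sum_div, Finset.sum_add_distrib,
      dP.2, dQ.2] at this
    linarith
  refine le_sInf ?_
  rintro _ ⟨n, rfl, hn⟩
  rw [← ENNReal.ofReal_natCast]
  refine ENNReal.ofReal_le_ofReal ?_
  rw [div_le_iff₀ hh]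
  by_contra! hlt
  have hover := pow_le_two_mul_sum_min dP dQ n
  have hpow : 1 - 2 * n * h ≤ (∑ x, √(P x * Q x)) ^ (2 * n) := by
    rcases le_or_gt 1 h with h1 | h1
    · rcases Nat.eq_zero_or_pos n with rfl | hn0
      · simp
      · have : (1 : ℝ) ≤ n := by exact_mod_cast hn0
        nlinarith
    · have hb := one_add_mul_le_pow (a := -h) (by linarith) (2 * n)
      push_cast at hb
      calc _ ≤ (1 + -h) ^ (2 * n) := by linarith
        _ ≤ _ := pow_le_pow_left₀ (by linarith) (by linarith) _
  have hbound {R : X → ℝ} (hR : IsDist R) {ψ : (Fin n → X) → ℝ} (hψ : ∀ x, ψ x ≤ 1) :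
      ∑ x : Fin n → X, (∏ i, R (x i)) * ψ x ≤ 1 := by
    rw [← hR.sum_prod_eq_one n]
    exact Finset.sum_le_sum fun x _ => mul_le_of_le_one_right (hR.prod_nonneg x) (hψ x)
  have : Nonempty {φ : (Fin n → X) → ℝ // ∀ x, 0 ≤ φ x ∧ φ x ≤ 1} :=
    ⟨⟨fun _ => 0, fun _ => by norm_num⟩⟩
  have hlow : ∑ x : Fin n → X, min (∏ i, P (x i)) (∏ i, Q (x i)) ≤ eStar Pcal Qcal n := by
    refine le_ciInf fun φ => ?_
    have h1 := le_ciSup (f := fun R : Pcal => ∑ x : Fin n → X, (∏ i, (R : X → ℝ) (x i)) * φ.1 x)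
      ⟨1, by rintro _ ⟨R, rfl⟩; exact hbound (hPcal _ R.2) fun x => (φ.2 x).2⟩ ⟨P, hP⟩
    have h2 := le_ciSup
      (f := fun R : Qcal => ∑ x : Fin n → X, (∏ i, (R : X → ℝ) (x i)) * (1 - φ.1 x))
      ⟨1, by rintro _ ⟨R, rfl⟩; exact hbound (hQcal _ R.2) fun x => by linarith [(φ.2 x).1]⟩
      ⟨Q, hQ⟩
    refine le_trans ?_ (add_le_add h1 h2)
    rw [← Finset.sum_add_distrib]
    refine Finset.sum_le_sum fun x _ => ?_
    have := mul_le_mul_of_nonneg_right (min_le_left (∏ i, P (x i)) (∏ i, Q (x i))) (φ.2 x).1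
    have := mul_le_mul_of_nonneg_right (min_le_right (∏ i, P (x i)) (∏ i, Q (x i)))
      (sub_nonneg.2 (φ.2 x).2)
    simp only
    linarith
  linarith

/-- If an event has probability at least `a` under one hypothesis and at most `b < a` under the
other one, then of order `a / (a - b) ^ 2` samples suffice. -/
lemma nStar_le_ofReal {Pcal Qcal : Set (X → ℝ)} (hPcal : ∀ P ∈ Pcal, IsDist P)
    (hQcal : ∀ Q ∈ Qcal, IsDist Q) (A : Finset X) {a b D : ℝ} (hb : 0 ≤ b) (hab : b < a)
    (ha : a ≤ 1) (hD : 0 < D) (hP : ∀ P ∈ Pcal, a ≤ ∑ x ∈ A, P x)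
    (hQ : ∀ Q ∈ Qcal, ∑ x ∈ A, Q x ≤ b) (haD : a * D ≤ 2 * (a - b) ^ 2) :
    nStar Pcal Qcal ≤ ENNReal.ofReal (200 / D) := by
  obtain ⟨n, hn1, hn2⟩ : ∃ n : ℕ, 80 * a ≤ n * (a - b) ^ 2 ∧ (n : ℝ) ≤ 200 / D := by
    have h0 : 0 < (a - b) ^ 2 := by have := sub_pos.2 hab; positivity
    refine ⟨⌈160 / D⌉₊, ?_, ?_⟩
    · have h1 := Nat.le_ceil (160 / D)
      rw [div_le_iff₀ hD] at h1
      have h2 := mul_le_mul_of_nonneg_left haD (Nat.cast_nonneg ⌈160 / D⌉₊ : (0 : ℝ) ≤ _)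
      nlinarith
    · have h1 := (Nat.ceil_lt_add_one (by positivity : 0 ≤ 160 / D)).le
      have h2 : D ≤ 2 := by nlinarith
      have h3 : 1 ≤ 40 / D := by rw [le_div_iff₀ hD]; linarith
      have h4 : 200 / D = 160 / D + 40 / D := by ring
      linarith
  have ha0 : 0 < a := hb.trans_lt hab
  have hn0 : 0 < n := by
    rcases Nat.eq_zero_or_pos n with rfl | h
    · norm_num at hn1; linarith
    · exact h
  suffices h : eStar Pcal Qcal n ≤ 1 / 10 from
    (sInf_le (show _ ∈ {N : ℝ≥0∞ | ∃ n : ℕ, N = n ∧ eStar Pcal Qcal n ≤ 1 / 10}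
      from ⟨n, rfl, h⟩)).trans
      ((ENNReal.ofReal_natCast n).symm.trans_le (ENNReal.ofReal_le_ofReal hn2))
  set φ : (Fin n → X) → ℝ := fun x =>
    if n * ((a + b) / 2) ≤ ∑ i, if x i ∈ A then (1 : ℝ) else 0 then 0 else 1 with hφ
  have hφ01 (x) : 0 ≤ φ x ∧ φ x ≤ 1 := by
    simp only [hφ]; split_ifs <;> norm_num
  have hn0' : (0 : ℝ) < n := by exact_mod_cast hn0
  have hbdd : BddBelow (Set.range fun φ : {φ : (Fin n → X) → ℝ // ∀ x, 0 ≤ φ x ∧ φ x ≤ 1} =>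
      errSum Pcal Qcal n φ.1) := by
    refine ⟨0, ?_⟩
    rintro _ ⟨φ, rfl⟩
    exact add_nonneg
      (Real.iSup_nonneg fun R => Finset.sum_nonneg fun x _ =>
        mul_nonneg ((hPcal _ R.2).prod_nonneg x) (φ.2 x).1)
      (Real.iSup_nonneg fun R => Finset.sum_nonneg fun x _ =>
        mul_nonneg ((hQcal _ R.2).prod_nonneg x) (sub_nonneg.2 (φ.2 x).2))
  refine (ciInf_le hbdd (⟨φ, hφ01⟩ : {φ : (Fin n → X) → ℝ // ∀ x, 0 ≤ φ x ∧ φ x ≤ 1})).trans ?_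
  have h1 : (⨆ P : Pcal, ∑ x : Fin n → X, (∏ i, (P : X → ℝ) (x i)) * φ x) ≤ 1 / 20 := by
    refine Real.iSup_le (fun ⟨P, hPm⟩ => ?_) (by norm_num)
    have hm := hP P hPm
    refine (hPcal P hPm).chebyshev A (r := ∑ x ∈ A, P x - (a + b) / 2) (by linarith) hn0 ?_
      (fun x => (hφ01 x).2) fun x hx => ?_
    · set m := ∑ x ∈ A, P x
      have key : m * (a - b) ^ 2 ≤ 4 * (a * (m - (a + b) / 2) ^ 2) := by
        nlinarith [mul_nonneg ha0.le (sq_nonneg (m - a)),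
          mul_nonneg (mul_nonneg (sub_nonneg.2 hm) (sub_nonneg.2 hab.le)) (by linarith : 0 ≤ a + b)]
      have h2 := mul_le_mul_of_nonneg_left key hn0'.le
      have h3 := mul_le_mul_of_nonneg_left hn1 (by linarith : 0 ≤ m)
      nlinarith
    · have hlt : ∑ i, (if x i ∈ A then (1 : ℝ) else 0) < n * ((a + b) / 2) := by
        by_contra! h
        simp only [hφ, if_pos h, lt_irrefl] at hx
      refine le_trans ?_ (neg_le_abs _)
      linarith
  have h2 : (⨆ Q : Qcal, ∑ x : Fin n → X, (∏ i, (Q : X → ℝ) (x i)) * (1 - φ x)) ≤ 1 / 20 := by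
    refine Real.iSup_le (fun ⟨Q, hQm⟩ => ?_) (by norm_num)
    have hm := hQ Q hQm
    refine (hQcal Q hQm).chebyshev A (r := (a + b) / 2 - ∑ x ∈ A, Q x) (by linarith) hn0 ?_
      (fun x => by linarith [(hφ01 x).1]) fun x hx => ?_
    · set m := ∑ x ∈ A, Q x
      have key : (a - b) ^ 2 ≤ 4 * ((a + b) / 2 - m) ^ 2 := by nlinarith
      have h2 := mul_le_mul_of_nonneg_left key hn0'.le
      nlinarith
    · have hle : n * ((a + b) / 2) ≤ ∑ i, (if x i ∈ A then (1 : ℝ) else 0) := by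
        by_contra! h
        simp only [hφ, if_neg (not_le.2 h), sub_self, lt_irrefl] at hx
      refine le_trans ?_ (le_abs_self _)
      linarith
  rw [errSum]
  linarith

end SampleComplexity

section ThreePoint

lemma ofReal_le_nStar_fin_three {Pcal Qcal : Set (Fin 3 → ℝ)} (hPcal : ∀ P ∈ Pcal, IsDist P)
    (hQcal : ∀ Q ∈ Qcal, IsDist Q) {P Q : Fin 3 → ℝ} (hP : P ∈ Pcal) (hQ : Q ∈ Qcal) {ε D : ℝ}
    (hD : 0 < D) (hεD : ε ^ 2 ≤ D) (h0 : 1 / 2 ≤ P 0 + Q 0) (h1 : 1 / 2 ≤ P 1 + Q 1)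
    (d0 : |P 0 - Q 0| ≤ 11 * ε) (d1 : |P 1 - Q 1| ≤ 11 * ε)
    (d2 : (P 2 - Q 2) ^ 2 ≤ 2 * D * (P 2 + Q 2)) :
    ENNReal.ofReal (1 / 2000 / D) ≤ nStar Pcal Qcal := by
  have hterm {u v : ℝ} (hv : 1 / 2 ≤ v) (hu : |u| ≤ 11 * ε) : u ^ 2 / v ≤ 242 * D := by
    rw [div_le_iff₀ (by linarith)]
    have := pow_le_pow_left₀ (abs_nonneg u) hu 2
    rw [sq_abs] at this
    nlinarith
  have hlast : (P 2 - Q 2) ^ 2 / (P 2 + Q 2) ≤ 2 * D :=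
    div_le_of_le_mul₀ (add_nonneg ((hPcal P hP).1 2) ((hQcal Q hQ).1 2)) (by positivity) d2
  have h := ofReal_le_nStar hPcal hQcal hP hQ (h := 800 * D) (by positivity) (by
    rw [Fin.sum_univ_three]
    linarith [hterm h0 d0, hterm h1 d1])
  convert h using 2
  field_simp
  norm_num

lemma isDist_fin_three {a b c : ℝ} (ha : 0 ≤ a) (hb : 0 ≤ b) (hc : 0 ≤ c) (h : a + b + c = 1) :
    IsDist ![a, b, c] := by
  refine ⟨fun x => ?_, ?_⟩
  · fin_cases x <;> simpa
  · simpa [Fin.sum_univ_three] using h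

lemma dTV_pEx_qEx {ε : ℝ} (hε : 0 ≤ ε) : dTV (pEx ε) qEx = 10 * ε := by
  simp only [dTV, pEx, qEx, Fin.sum_univ_three, Matrix.cons_val]
  rw [show 1 / 2 - 10 * ε - 1 / 2 = -(10 * ε) by ring, show 1 / 2 + 8 * ε - 1 / 2 = 8 * ε by ring,
    sub_zero, abs_neg, abs_of_nonneg (by positivity), abs_of_nonneg (by positivity),
    abs_of_nonneg (by positivity)]
  ring

lemma IsDist.sum_three {P : Fin 3 → ℝ} (hP : IsDist P) : P 0 + P 1 + P 2 = 1 := by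
  rw [← Fin.sum_univ_three, hP.2]

variable {ε δ D e : ℝ}

/-! ### Total variation contamination -/

lemma ofReal_le_nStar_PTV (hε : 0 < ε) (hε' : ε ≤ 1 / 100) (hδ : 0 ≤ δ) (hδε : δ ≤ ε / 2)
    (hεD : ε ^ 2 ≤ D) (hδD : δ ^ 2 ≤ ε * D) :
    ENNReal.ofReal (1 / 2000 / D) ≤ nStar (PTV (pEx ε) (ε - δ)) (PTV qEx (ε - δ)) := by
  have hD : 0 < D := lt_of_lt_of_le (by positivity) hεD
  refine ofReal_le_nStar_fin_three (Pcal := PTV (pEx ε) (ε - δ))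
    (Qcal := PTV qEx (ε - δ)) (fun _ h => h.1) (fun _ h => h.1)
    (P := ![1 / 2 - 10 * ε + (ε - δ), 1 / 2 + 8 * ε, 2 * ε - (ε - δ)])
    (Q := ![1 / 2 - (ε - δ), 1 / 2, ε - δ]) ⟨isDist_fin_three ?_ ?_ ?_ ?_, ?_⟩
    ⟨isDist_fin_three ?_ ?_ ?_ ?_, ?_⟩ hD hεD ?_ ?_ ?_ ?_ ?_
  case refine_5 =>
    simp only [dTV, pEx, Fin.sum_univ_three, Matrix.cons_val]
    rw [add_sub_cancel_left, sub_self, sub_sub_cancel_left, abs_neg, abs_zero,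
      abs_of_nonneg (by linarith)]
    linarith
  case refine_10 =>
    simp only [dTV, qEx, Fin.sum_univ_three, Matrix.cons_val]
    rw [sub_sub_cancel_left, sub_self, sub_zero, abs_neg, abs_zero, abs_of_nonneg (by linarith)]
    linarith
  all_goals try simp only [Matrix.cons_val, abs_le]
  all_goals first | linarith | (constructor <;> linarith)

lemma PTV_apply_bounds {P p : Fin 3 → ℝ} (hp : IsDist p) (hP : P ∈ PTV p e) (i : Fin 3) :
    |P i - p i| ≤ e := by
  obtain ⟨hP, h⟩ := hP
  rw [dTV, Fin.sum_univ_three] at h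
  have h1 := hP.sum_three
  have h2 := hp.sum_three
  have := neg_abs_le (P 0 - p 0)
  have := neg_abs_le (P 1 - p 1)
  have := neg_abs_le (P 2 - p 2)
  have := le_abs_self (P 0 - p 0)
  have := le_abs_self (P 1 - p 1)
  have := le_abs_self (P 2 - p 2)
  rw [abs_le]
  fin_cases i <;> simp only [Fin.mk_zero, Fin.mk_one, Fin.reduceFinMk] <;> constructor <;> linarith

lemma isDist_pEx (hε : 0 ≤ ε) (hε' : ε ≤ 1 / 100) : IsDist (pEx ε) :=
  isDist_fin_three (by linarith) (by linarith) (by linarith) (by ring)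

lemma isDist_qEx : IsDist qEx :=
  isDist_fin_three (by norm_num) (by norm_num) le_rfl (by norm_num)

lemma nStar_PTV_le_of_sq (hε : 0 < ε) (hε' : ε ≤ 1 / 100) :
    nStar (PTV (pEx ε) ε) (PTV qEx ε) ≤ ENNReal.ofReal (200 / ε ^ 2) := by
  refine nStar_le_ofReal (fun _ h => h.1) (fun _ h => h.1) {1, 2} (a := 1 / 2 + 9 * ε)
    (b := 1 / 2 + ε) (by linarith) (by linarith) (by linarith) (by positivity)
    (fun P hP => ?_) (fun Q hQ => ?_) (by nlinarith)
  · have h := (abs_le.1 (PTV_apply_bounds (isDist_pEx hε.le hε') hP 0)).2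
    have := hP.1.sum_three
    simp [pEx] at h ⊢
    linarith
  · have h := (abs_le.1 (PTV_apply_bounds isDist_qEx hQ 0)).1
    have := hQ.1.sum_three
    simp [qEx] at h ⊢
    linarith

lemma nStar_PTV_le (hε : 0 < ε) (hε' : ε ≤ 1 / 100) (hδ : 0 < δ) (hδε : δ ≤ ε / 2) (hD : 0 < D)
    (hδD : δ ^ 2 = ε * D) :
    nStar (PTV (pEx ε) (ε - δ)) (PTV qEx (ε - δ)) ≤ ENNReal.ofReal (200 / D) := by
  refine nStar_le_ofReal (fun _ h => h.1) (fun _ h => h.1) {2} (a := ε + δ)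
    (b := ε - δ) (by linarith) (by linarith) (by linarith) hD
    (fun P hP => ?_) (fun Q hQ => ?_) (by nlinarith)
  · have h := (abs_le.1 (PTV_apply_bounds (isDist_pEx hε.le hε') hP 2)).1
    simp [pEx] at h ⊢
    linarith
  · have h := (abs_le.1 (PTV_apply_bounds isDist_qEx hQ 2)).2
    simp [qEx] at h ⊢
    linarith

/-! ### Huber contamination -/

lemma ofReal_le_nStar_PHub (hε : 0 < ε) (hε' : ε ≤ 1 / 100) (hδ : 0 ≤ δ) (hδε : δ ≤ ε / 2)
    (hεD : ε ^ 2 ≤ D) (hδD : δ ^ 2 ≤ ε * D) (he : (e + δ) * (1 + 2 * ε) = 2 * ε) :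
    ENNReal.ofReal (1 / 2000 / D) ≤ nStar (PHub (pEx ε) e) (PHub qEx e) := by
  have hD : 0 < D := lt_of_lt_of_le (by positivity) hεD
  have he0 : 0 ≤ e := by nlinarith
  have he2 : e ≤ 2 * ε := by nlinarith
  have hmul : 0 ≤ e * ε ∧ e * ε ≤ e / 100 := by constructor <;> nlinarith
  have hmul' : 0 ≤ δ * ε ∧ δ * ε ≤ δ / 100 := by constructor <;> nlinarith
  refine ofReal_le_nStar_fin_three (Pcal := PHub (pEx ε) e) (Qcal := PHub qEx e) (fun _ h => h.1)
    (fun _ h => h.1) (P := ![(1 - e) * (1 / 2 - 10 * ε) + e, (1 - e) * (1 / 2 + 8 * ε),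
      (1 - e) * (2 * ε)])
    (Q := ![(1 - e) * (1 / 2), (1 - e) * (1 / 2), e]) ⟨isDist_fin_three ?_ ?_ ?_ ?_, fun x => ?_⟩
    ⟨isDist_fin_three ?_ ?_ ?_ ?_, fun x => ?_⟩ hD hεD ?_ ?_ ?_ ?_ ?_
  case refine_5 => fin_cases x <;> simp [pEx, he0]
  case refine_10 => fin_cases x <;> simp [qEx, he0]
  case refine_15 =>
    simp only [Matrix.cons_val]
    have h1 : (1 - e) * (2 * ε) - e = δ * (1 + 2 * ε) := by linarith
    have h2 : ε ≤ (1 - e) * (2 * ε) + e := by nlinarith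
    rw [h1, mul_pow]
    have h3 : (1 + 2 * ε) ^ 2 ≤ 2 := by nlinarith
    nlinarith [mul_le_mul_of_nonneg_left h3 (sq_nonneg δ), mul_le_mul_of_nonneg_left h2 hD.le]
  all_goals try simp only [Matrix.cons_val, abs_le]
  all_goals first | linarith | (constructor <;> linarith)

lemma nStar_PHub_le_of_sq (hε : 0 < ε) (hε' : ε ≤ 1 / 100) (he : e * (1 + 2 * ε) = 2 * ε) :
    nStar (PHub (pEx ε) e) (PHub qEx e) ≤ ENNReal.ofReal (200 / ε ^ 2) := by
  have he0 : 0 ≤ e := by nlinarith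
  have he2 : e ≤ 2 * ε := by nlinarith
  have hgap : 7 * ε ≤ (1 - e) * (1 / 2 + 10 * ε) - (1 + e) / 2 := by nlinarith
  refine nStar_le_ofReal (fun _ h => h.1) (fun _ h => h.1) {1, 2}
    (a := (1 - e) * (1 / 2 + 10 * ε)) (b := (1 + e) / 2) (by linarith) (by linarith) (by nlinarith)
    (by positivity) (fun P hP => ?_) (fun Q hQ => ?_) ?_
  · have h1 := hP.2 1
    have h2 := hP.2 2
    simp [pEx] at h1 h2 ⊢
    linarith
  · have h := hQ.2 0
    have := hQ.1.sum_three
    simp [qEx] at h ⊢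
    linarith
  · have h1 := pow_le_pow_left₀ (by positivity) hgap 2
    have h2 : (1 - e) * (1 / 2 + 10 * ε) ≤ 1 := by nlinarith
    nlinarith [mul_le_mul_of_nonneg_right h2 (sq_nonneg ε)]

lemma nStar_PHub_le (hε : 0 < ε) (hε' : ε ≤ 1 / 100) (hδ : 0 < δ) (hδε : δ ≤ ε / 2) (hD : 0 < D)
    (hδD : δ ^ 2 = ε * D) (he : (e + δ) * (1 + 2 * ε) = 2 * ε) :
    nStar (PHub (pEx ε) e) (PHub qEx e) ≤ ENNReal.ofReal (200 / D) := by
  have he0 : 0 ≤ e := by nlinarith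
  have hgap : (1 - e) * (2 * ε) - e = δ * (1 + 2 * ε) := by linarith
  have hδ' : δ ≤ δ * (1 + 2 * ε) := by nlinarith
  refine nStar_le_ofReal (fun _ h => h.1) (fun _ h => h.1) {2} (a := (1 - e) * (2 * ε)) (b := e)
    he0 (by linarith) (by nlinarith) hD (fun P hP => ?_) (fun Q hQ => ?_) ?_
  · simpa [pEx] using hP.2 2
  · have h0 := hQ.2 0
    have h1 := hQ.2 1
    have := hQ.1.sum_three
    simp [qEx] at h0 h1 ⊢
    linarith
  · rw [hgap]
    have h1 := pow_le_pow_left₀ hδ.le hδ' 2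
    nlinarith [mul_pos hε hD]

/-! ### Subtractive contamination -/

lemma ofReal_le_nStar_PSub (hε : 0 < ε) (hε' : ε ≤ 1 / 100) (hδ : 0 ≤ δ) (hδε : δ ≤ ε / 2)
    (hεD : ε ^ 2 ≤ D) (hδD : δ ≤ D) (he : (e + δ) * (1 - 2 * ε) = 2 * ε) :
    ENNReal.ofReal (1 / 2000 / D) ≤ nStar (PSub (pEx ε) e) (PSub qEx e) := by
  have hD : 0 < D := lt_of_lt_of_le (by positivity) hεD
  have he0 : 0 ≤ e := by nlinarith
  have he2 : e ≤ 3 * ε := by nlinarith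
  have hmul : 0 ≤ e * ε ∧ e * ε ≤ e / 100 := by constructor <;> nlinarith
  have hmul' : 0 ≤ δ * ε ∧ δ * ε ≤ δ / 100 := by constructor <;> nlinarith
  refine ofReal_le_nStar_fin_three (Pcal := PSub (pEx ε) e) (Qcal := PSub qEx e) (fun _ h => h.1)
    (fun _ h => h.1) (P := ![(1 + e) * (1 / 2 - 10 * ε), (1 + e) * (1 / 2 + 8 * ε),
      δ * (1 - 2 * ε)])
    (Q := qEx) ⟨isDist_fin_three ?_ ?_ ?_ ?_, fun x => ?_⟩
    ⟨isDist_qEx, fun x => ?_⟩ hD hεD ?_ ?_ ?_ ?_ ?_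
  case refine_5 =>
    fin_cases x <;> simp [pEx]
    linarith
  case refine_6 => nlinarith [isDist_qEx.1 x]
  all_goals try simp only [qEx, Matrix.cons_val, abs_le]
  case refine_11 => nlinarith
  all_goals first | linarith | (constructor <;> linarith)

lemma nStar_PSub_le_of_sq (hε : 0 < ε) (hε' : ε ≤ 1 / 100) (he : e * (1 - 2 * ε) = 2 * ε) :
    nStar (PSub (pEx ε) e) (PSub qEx e) ≤ ENNReal.ofReal (200 / ε ^ 2) := by
  have he0 : 0 ≤ e := by nlinarith
  have he2 : e ≤ 3 * ε := by nlinarith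
  have hgap : 7 * ε ≤ 1 - (1 + e) * (1 / 2 - 10 * ε) - (1 + e) / 2 := by nlinarith
  have ha : 1 - (1 + e) * (1 / 2 - 10 * ε) ≤ 1 := by nlinarith
  refine nStar_le_ofReal (fun _ h => h.1) (fun _ h => h.1) {1, 2}
    (a := 1 - (1 + e) * (1 / 2 - 10 * ε)) (b := (1 + e) / 2) (by linarith) (by linarith) ha
    (by positivity) (fun P hP => ?_) (fun Q hQ => ?_) ?_
  · have h := hP.2 0
    have := hP.1.sum_three
    simp [pEx] at h ⊢
    linarith
  · have h1 := hQ.2 1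
    have h2 := hQ.2 2
    simp [qEx] at h1 h2 ⊢
    linarith
  · have h1 := pow_le_pow_left₀ (by positivity) hgap 2
    nlinarith [mul_le_mul_of_nonneg_right ha (sq_nonneg ε)]

lemma nStar_PSub_le (hε : 0 < ε) (hε' : ε ≤ 1 / 100) (hδ : 0 < δ) (hδε : δ ≤ ε / 2)
    (he : (e + δ) * (1 - 2 * ε) = 2 * ε) :
    nStar (PSub (pEx ε) e) (PSub qEx e) ≤ ENNReal.ofReal (200 / δ) := by
  have hδ' : δ / 2 ≤ δ * (1 - 2 * ε) := by nlinarith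
  refine nStar_le_ofReal (fun _ h => h.1) (fun _ h => h.1) {2} (a := δ * (1 - 2 * ε)) (b := 0)
    le_rfl (by linarith) (by nlinarith) hδ (fun P hP => ?_) (fun Q hQ => ?_) (by nlinarith)
  · have h0 := hP.2 0
    have h1 := hP.2 1
    have := hP.1.sum_three
    simp [pEx] at h0 h1 ⊢
    linarith
  · simpa [qEx] using hQ.2 2

/-! ### Scaling of the perturbation -/

lemma exists_forall_rpow_le_half {t : ℝ} (ht : 0 < t) :
    ∃ ε₀ : ℝ, 0 < ε₀ ∧ ∀ ε : ℝ, 0 < ε → ε < ε₀ → ε ≤ 1 / 100 ∧ ε ^ (1 + t) ≤ ε / 2 := by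
  refine ⟨min (1 / 100) ((1 / 2) ^ t⁻¹), by positivity, fun ε hε hlt => ⟨?_, ?_⟩⟩
  · exact (hlt.trans_le (min_le_left _ _)).le
  · have h := Real.rpow_le_rpow hε.le (hlt.trans_le (min_le_right _ _)).le ht.le
    rw [Real.rpow_inv_rpow (by norm_num) ht.ne'] at h
    rw [Real.rpow_add hε, Real.rpow_one]
    nlinarith

lemma sq_le_rpow_of_le_two (hε : 0 < ε) (hε' : ε ≤ 1 / 100) {s : ℝ} (hs : s ≤ 2) :
    ε ^ 2 ≤ ε ^ s := by
  rw [← Real.rpow_two]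
  exact Real.rpow_le_rpow_of_exponent_ge hε (by linarith) hs

lemma rpow_one_add_sq (hε : 0 < ε) (t : ℝ) : (ε ^ (1 + t)) ^ 2 = ε * ε ^ (1 + 2 * t) := by
  rw [← Real.rpow_two, ← Real.rpow_mul hε.le, show (1 + t) * 2 = 1 + (1 + 2 * t) by ring,
    Real.rpow_add hε, Real.rpow_one]

end ThreePoint

/-- Polynomial jumps in the robust sample complexity for the three-point example, in the TV,
Huber and subtractive contamination models. -/
theorem polynomial_jumps_in_sample_complexity :
    -- (i) TV contamination
    (∀ t : ℝ, 0 < t → t < 1 / 2 →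
      ∃ c C ε₀ : ℝ, 0 < c ∧ 0 < C ∧ 0 < ε₀ ∧
        ∀ ε : ℝ, 0 < ε → ε < ε₀ →
          dTV (pEx ε) qEx = 10 * ε ∧
          0 < ε - ε ^ (1 + t) ∧ ε - ε ^ (1 + t) < ε ∧ ε ≤ dTV (pEx ε) qEx / 4 ∧
          ENNReal.ofReal (c / ε ^ 2) ≤ nStar (PTV (pEx ε) ε) (PTV qEx ε) ∧
          nStar (PTV (pEx ε) ε) (PTV qEx ε) ≤ ENNReal.ofReal (C / ε ^ 2) ∧
          ENNReal.ofReal (c / ε ^ (1 + 2 * t)) ≤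
            nStar (PTV (pEx ε) (ε - ε ^ (1 + t))) (PTV qEx (ε - ε ^ (1 + t))) ∧
          nStar (PTV (pEx ε) (ε - ε ^ (1 + t))) (PTV qEx (ε - ε ^ (1 + t))) ≤
            ENNReal.ofReal (C / ε ^ (1 + 2 * t))) ∧
    -- (ii) Huber contamination
    (∀ t : ℝ, 0 < t → t < 1 / 2 →
      ∃ c C ε₀ : ℝ, 0 < c ∧ 0 < C ∧ 0 < ε₀ ∧
        ∀ ε : ℝ, 0 < ε → ε < ε₀ →
          dTV (pEx ε) qEx = 10 * ε ∧
          0 < 2 * ε / (1 + 2 * ε) - ε ^ (1 + t) ∧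
          2 * ε / (1 + 2 * ε) - ε ^ (1 + t) < 2 * ε / (1 + 2 * ε) ∧
          2 * ε / (1 + 2 * ε) ≤ dTV (pEx ε) qEx / 4 ∧
          ENNReal.ofReal (c / ε ^ 2) ≤
            nStar (PHub (pEx ε) (2 * ε / (1 + 2 * ε))) (PHub qEx (2 * ε / (1 + 2 * ε))) ∧
          nStar (PHub (pEx ε) (2 * ε / (1 + 2 * ε))) (PHub qEx (2 * ε / (1 + 2 * ε))) ≤
            ENNReal.ofReal (C / ε ^ 2) ∧
          ENNReal.ofReal (c / ε ^ (1 + 2 * t)) ≤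
            nStar (PHub (pEx ε) (2 * ε / (1 + 2 * ε) - ε ^ (1 + t)))
              (PHub qEx (2 * ε / (1 + 2 * ε) - ε ^ (1 + t))) ∧
          nStar (PHub (pEx ε) (2 * ε / (1 + 2 * ε) - ε ^ (1 + t)))
              (PHub qEx (2 * ε / (1 + 2 * ε) - ε ^ (1 + t))) ≤
            ENNReal.ofReal (C / ε ^ (1 + 2 * t))) ∧
    -- (iii) subtractive contamination
    (∀ t : ℝ, 0 < t → t < 1 →
      ∃ c C ε₀ : ℝ, 0 < c ∧ 0 < C ∧ 0 < ε₀ ∧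
        ∀ ε : ℝ, 0 < ε → ε < ε₀ →
          dTV (pEx ε) qEx = 10 * ε ∧
          0 < 2 * ε / (1 - 2 * ε) - ε ^ (1 + t) ∧
          2 * ε / (1 - 2 * ε) - ε ^ (1 + t) < 2 * ε / (1 - 2 * ε) ∧
          2 * ε / (1 - 2 * ε) ≤ dTV (pEx ε) qEx / 4 ∧
          ENNReal.ofReal (c / ε ^ 2) ≤
            nStar (PSub (pEx ε) (2 * ε / (1 - 2 * ε))) (PSub qEx (2 * ε / (1 - 2 * ε))) ∧
          nStar (PSub (pEx ε) (2 * ε / (1 - 2 * ε))) (PSub qEx (2 * ε / (1 - 2 * ε))) ≤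
            ENNReal.ofReal (C / ε ^ 2) ∧
          ENNReal.ofReal (c / ε ^ (1 + t)) ≤
            nStar (PSub (pEx ε) (2 * ε / (1 - 2 * ε) - ε ^ (1 + t)))
              (PSub qEx (2 * ε / (1 - 2 * ε) - ε ^ (1 + t))) ∧
          nStar (PSub (pEx ε) (2 * ε / (1 - 2 * ε) - ε ^ (1 + t)))
              (PSub qEx (2 * ε / (1 - 2 * ε) - ε ^ (1 + t))) ≤
            ENNReal.ofReal (C / ε ^ (1 + t))) := by
  refine ⟨fun t ht ht' => ?_, fun t ht ht' => ?_, fun t ht ht' => ?_⟩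
  all_goals
    obtain ⟨ε₀, hε₀, hsmall⟩ := exists_forall_rpow_le_half ht
    refine ⟨1 / 2000, 200, ε₀, by norm_num, by norm_num, hε₀, fun ε hε hlt => ?_⟩
    obtain ⟨hε', hδε⟩ := hsmall ε hε hlt
    have hδ : 0 < ε ^ (1 + t) := by positivity
    have hsq := rpow_one_add_sq hε t
    rw [dTV_pEx_qEx hε.le]
    refine ⟨rfl, ?_⟩
  · have hD : 0 < ε ^ (1 + 2 * t) := by positivity
    have h0 := ofReal_le_nStar_PTV hε hε' le_rfl (by positivity) le_rfl
      (by rw [zero_pow two_ne_zero]; positivity)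
    rw [sub_zero] at h0
    exact ⟨by linarith, by linarith, by linarith, h0, nStar_PTV_le_of_sq hε hε',
      ofReal_le_nStar_PTV hε hε' hδ.le hδε (sq_le_rpow_of_le_two hε hε' (by linarith)) hsq.le,
      nStar_PTV_le hε hε' hδ hδε hD hsq⟩
  · have hD : 0 < ε ^ (1 + 2 * t) := by positivity
    have he : 2 * ε / (1 + 2 * ε) * (1 + 2 * ε) = 2 * ε := div_mul_cancel₀ _ (by positivity)
    have he' : (2 * ε / (1 + 2 * ε) - ε ^ (1 + t) + ε ^ (1 + t)) * (1 + 2 * ε) = 2 * ε := by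
      rw [sub_add_cancel, he]
    exact ⟨by nlinarith, by linarith, by nlinarith,
      ofReal_le_nStar_PHub hε hε' le_rfl (by positivity) le_rfl
        (by rw [zero_pow two_ne_zero]; positivity) (by simpa using he),
      nStar_PHub_le_of_sq hε hε' he,
      ofReal_le_nStar_PHub hε hε' hδ.le hδε (sq_le_rpow_of_le_two hε hε' (by linarith)) hsq.le he',
      nStar_PHub_le hε hε' hδ hδε hD hsq he'⟩
  · have he : 2 * ε / (1 - 2 * ε) * (1 - 2 * ε) = 2 * ε := div_mul_cancel₀ _ (by linarith)
    have he' : (2 * ε / (1 - 2 * ε) - ε ^ (1 + t) + ε ^ (1 + t)) * (1 - 2 * ε) = 2 * ε := by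
      rw [sub_add_cancel, he]
    exact ⟨by nlinarith, by linarith, by nlinarith,
      ofReal_le_nStar_PSub hε hε' le_rfl (by positivity) le_rfl (sq_nonneg ε) (by simpa using he),
      nStar_PSub_le_of_sq hε hε' he,
      ofReal_le_nStar_PSub hε hε' hδ.le hδε (sq_le_rpow_of_le_two hε hε' (by linarith)) le_rfl he',
      nStar_PSub_le hε hε' hδ hδε he'⟩

end
end

section
/- Let p be a distribution on a nonempty finite set X and let 0 < ε₀ < ε < 1. (i) If p_ε is a distribution on X with d_TV(p_ε, p) ≤ ε, then there exists a distribution p₀ on X with d_TV(p₀, p) ≤ ε₀ and d_TV(p_ε, p₀) ≤ ε − ε₀. (ii) If p_ε ∈ 𝒫_Hub(p,ε), then there exists p₀ ∈ 𝒫_Hub(p,ε₀) with d_TV(p_ε, p₀) ≤ ε − ε₀. (iii) If p_ε ∈ 𝒫_Sub(p,ε), then there exists p₀ ∈ 𝒫_Sub(p,ε₀) with d_TV(p_ε, p₀) ≤ ε − ε₀. -/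
open scoped Classical
open Finset

noncomputable section

/-- The mixture of `p` and `q` giving weight `t` to `q`. -/
def mixture {X : Type*} (p q : X → ℝ) (t : ℝ) : X → ℝ :=
  fun x => (1 - t) * p x + t * q x

lemma IsDist.mixture {X : Type*} [Fintype X] {p q : X → ℝ} (hp : IsDist p) (hq : IsDist q)
    {t : ℝ} (ht0 : 0 ≤ t) (ht1 : t ≤ 1) : IsDist (mixture p q t) := by
  refine ⟨fun x => add_nonneg (mul_nonneg (sub_nonneg.2 ht1) (hp.1 x))
    (mul_nonneg ht0 (hq.1 x)), ?_⟩
  simp only [_root_.mixture, sum_add_distrib, ← mul_sum, hp.2, hq.2]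
  ring

lemma dTV_mixture_left {X : Type*} [Fintype X] (p q : X → ℝ) {t : ℝ} (ht0 : 0 ≤ t) :
    dTV (mixture p q t) p = t * dTV q p := by
  have h (x : X) : |mixture p q t x - p x| = t * |q x - p x| := by
    rw [show mixture p q t x - p x = t * (q x - p x) by rw [mixture]; ring,
      abs_mul, abs_of_nonneg ht0]
  simp only [dTV, h, ← mul_sum]
  ring

lemma dTV_mixture_right {X : Type*} [Fintype X] (p q : X → ℝ) {t : ℝ} (ht1 : t ≤ 1) :
    dTV q (mixture p q t) = (1 - t) * dTV q p := by
  have h (x : X) : |q x - mixture p q t x| = (1 - t) * |q x - p x| := by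
    rw [show q x - mixture p q t x = (1 - t) * (q x - p x) by rw [mixture]; ring,
      abs_mul, abs_of_nonneg (sub_nonneg.2 ht1)]
  simp only [dTV, h, ← mul_sum]
  ring

lemma dTV_le_of_mem_PHub {X : Type*} [Fintype X] {p q : X → ℝ} (hp : IsDist p) {ε : ℝ}
    (hε : 0 ≤ ε) (hq : q ∈ PHub p ε) : dTV q p ≤ ε := by
  have h : ∑ x, |q x - p x| ≤ ∑ x, (q x - p x + 2 * ε * p x) := by
    refine sum_le_sum fun x _ => abs_le.2 ⟨?_, ?_⟩
    · linarith [hq.2 x]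
    · linarith [mul_nonneg hε (hp.1 x)]
  rw [sum_add_distrib, sum_sub_distrib, ← mul_sum, hp.2, hq.1.2] at h
  rw [dTV]
  linarith

lemma dTV_le_of_mem_PSub {X : Type*} [Fintype X] {p q : X → ℝ} (hp : IsDist p) {ε : ℝ}
    (hε : 0 ≤ ε) (hq : q ∈ PSub p ε) : dTV q p ≤ ε := by
  have h : ∑ x, |q x - p x| ≤ ∑ x, (p x - q x + 2 * ε * p x) := by
    refine sum_le_sum fun x _ => abs_le.2 ⟨?_, ?_⟩
    · linarith [mul_nonneg hε (hp.1 x)]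
    · linarith [hq.2 x]
  rw [sum_add_distrib, sum_sub_distrib, ← mul_sum, hp.2, hq.1.2] at h
  rw [dTV]
  linarith

lemma mixture_mem_PHub {X : Type*} [Fintype X] {p q : X → ℝ} (hp : IsDist p) {ε t : ℝ}
    (ht0 : 0 ≤ t) (ht1 : t ≤ 1) (hq : q ∈ PHub p ε) : mixture p q t ∈ PHub p (t * ε) := by
  refine ⟨hp.mixture hq.1 ht0 ht1, fun x => ?_⟩
  rw [mixture]
  linarith [mul_le_mul_of_nonneg_left (hq.2 x) ht0]

lemma mixture_mem_PSub {X : Type*} [Fintype X] {p q : X → ℝ} (hp : IsDist p) {ε t : ℝ}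
    (ht0 : 0 ≤ t) (ht1 : t ≤ 1) (hq : q ∈ PSub p ε) : mixture p q t ∈ PSub p (t * ε) := by
  refine ⟨hp.mixture hq.1 ht0 ht1, fun x => ?_⟩
  rw [mixture]
  linarith [mul_le_mul_of_nonneg_left (hq.2 x) ht0]

/-- Any point of the ε-uncertainty set (TV, Huber or subtractive) is within TV distance
`ε − ε₀` of some point of the corresponding ε₀-uncertainty set. -/
theorem tv_ball_inside_uncertainty_sets
    {X : Type*} [Fintype X] [Nonempty X]
    (p : X → ℝ) (hp : IsDist p)
    (ε₀ ε : ℝ) (h0 : 0 < ε₀) (h01 : ε₀ < ε) (h1 : ε < 1) :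
    (∀ pe : X → ℝ, IsDist pe → dTV pe p ≤ ε →
      ∃ p₀ : X → ℝ, IsDist p₀ ∧ dTV p₀ p ≤ ε₀ ∧ dTV pe p₀ ≤ ε - ε₀) ∧
    (∀ pe : X → ℝ, pe ∈ PHub p ε →
      ∃ p₀ ∈ PHub p ε₀, dTV pe p₀ ≤ ε - ε₀) ∧
    (∀ pe : X → ℝ, pe ∈ PSub p ε →
      ∃ p₀ ∈ PSub p ε₀, dTV pe p₀ ≤ ε - ε₀) := by
  have hε : 0 < ε := h0.trans h01
  obtain ⟨t, rfl⟩ : ∃ t, ε₀ = t * ε := ⟨ε₀ / ε, (div_mul_cancel₀ ε₀ hε.ne').symm⟩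
  have ht0 : 0 ≤ t := (pos_of_mul_pos_left h0 hε.le).le
  have ht1 : t ≤ 1 := by
    by_contra! h
    linarith [mul_lt_mul_of_pos_right h hε]
  have key (q : X → ℝ) (hq : dTV q p ≤ ε) : dTV q (mixture p q t) ≤ ε - t * ε := by
    rw [dTV_mixture_right p q ht1]
    linarith [mul_le_mul_of_nonneg_left hq (sub_nonneg.2 ht1)]
  refine ⟨fun q hq hd => ⟨mixture p q t, hp.mixture hq ht0 ht1, ?_, key q hd⟩,
    fun q hq => ⟨mixture p q t, mixture_mem_PHub hp ht0 ht1 hq,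
      key q (dTV_le_of_mem_PHub hp hε.le hq)⟩,
    fun q hq => ⟨mixture p q t, mixture_mem_PSub hp ht0 ht1 hq,
      key q (dTV_le_of_mem_PSub hp hε.le hq)⟩⟩
  rw [dTV_mixture_left p q ht0]
  exact mul_le_mul_of_nonneg_left hd ht0

end
end

section
/- Fix X = {1,2,3}, and for ε ∈ (0, 1/40) let p = (1/2 − 10ε, 1/2 + 8ε, 2ε) and q = (1/2, 1/2, 0). For nonnegative vectors a, b on X let S_n(x₁,…,x_n) = ∑_{i=1}^n log(a(x_i)/b(x_i)) (the n-sample log-likelihood statistic of the test that declares p iff S_n ≥ 0). Then: (i) [TV] For every t with 0 < t < 1/3 there exists ε₀(t) > 0 such that for all ε ∈ (0, ε₀(t)), setting δ = ε^{1+t}, a = (1/2 − 9ε − δ, 1/2 + 8ε, ε + δ), b = (1/2 − ε + δ, 1/2, ε − δ) (the TV least favourable distributions at level ε₁ = ε − δ), and Q₂ = (1/2 − ε, 1/2, ε), one has Q₂ ∈ 𝒫_TV(q, ε) and P_{x ∼ Q₂^{⊗n}}(S_n(x) ≥ 0) → 1 as n → ∞. (ii) [Huber] For every t with 0 < t < 1/2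 there exists ε₀(t) > 0 such that for all ε ∈ (0, ε₀(t)), setting ε₂ = 2ε/(1+2ε), δ = ε^{1+t}, ε₁ = ε₂ − δ, a = ((1−ε₁)(1/2−10ε)+ε₁, (1−ε₁)(1/2+8ε), 2ε(1−ε₁)), b = ((1−ε₁)/2, (1−ε₁)/2, ε₁) (the Huber least favourable distributions at level ε₁), and Q₂ = ((1−ε₂)/2, (1−ε₂)/2, ε₂), one has Q₂ ∈ 𝒫_Hub(q, ε₂) and P_{x ∼ Q₂^{⊗n}}(S_n(x) ≥ 0) → 1 as n → ∞. (iii) [Subtractive] For every t with 0 < t < 1 there exists ε₀(t) > 0 such that for all ε ∈ (0, ε₀(t)), setting ε₂ = 2ε/(1−2ε), δ = ε^{1+t}, ε₁ = ε₂ − δ, a = ((1+ε₁)(1/2−10ε), (1+ε₁)(1/2+8ε), 2ε(1+ε₁)−ε₁), b = ((1−ε₁)/2, (1+ε₁)/2, 0) (the subtractive least favourable distributions at level ε₁), and P₂ = ((1+ε₂)(1/2−10ε), (1+ε₂)(1/2+8ε), 0), one has P₂ ∈ 𝒫_Sub(p, ε₂) and P_{x ∼ P₂^{⊗n}}(S_n(x)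 < 0) → 1 as n → ∞ (since P₂(3) = 0, the coordinate with b = 0 occurs with probability zero under P₂). In each case the test calibrated to the underestimated contamination level ε₁ has at least one of its two error probabilities tending to 1 under ε₂-contamination. -/
open scoped Classical
open Finset

noncomputable section

/-- The `n`-sample log-likelihood statistic `S_n(x) = ∑ᵢ log(a(xᵢ)/b(xᵢ))`. -/
def Sstat (a b : Fin 3 → ℝ) {n : ℕ} (x : Fin n → Fin 3) : ℝ :=
  ∑ i, Real.log (a (x i) / b (x i))

/-- Probability under `r^{⊗n}` that `S_n ≥ 0`. -/
def probSge (r a b : Fin 3 → ℝ) (n : ℕ) : ℝ :=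
  ∑ x : Fin n → Fin 3, if 0 ≤ Sstat a b x then ∏ i, r (x i) else 0

/-- Probability under `r^{⊗n}` that `S_n < 0`. -/
def probSlt (r a b : Fin 3 → ℝ) (n : ℕ) : ℝ :=
  ∑ x : Fin n → Fin 3, if Sstat a b x < 0 then ∏ i, r (x i) else 0

open Filter Topology

/-- If the increment has negative mean, some exponential moment is smaller than one. -/
lemma exists_sum_mul_exp_lt_one {X : Type*} [Fintype X] {r f : X → ℝ} (hr : IsDist r)
    (hf : ∑ x, r x * f x < 0) : ∃ c > 0, ∑ x, r x * Real.exp (c * f x) < 1 := by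
  have hd : HasDerivAt (fun c : ℝ => ∑ x, r x * Real.exp (c * f x)) (∑ x, r x * f x) 0 := by
    refine HasDerivAt.fun_sum fun x _ => ?_
    have h := (((hasDerivAt_id (0 : ℝ)).mul_const (f x)).exp).const_mul (r x)
    simpa using h
  have h := hd.tendsto_slope_zero_right.eventually (gt_mem_nhds hf)
  obtain ⟨c, hc, hpos⟩ := (h.and self_mem_nhdsWithin).exists
  have hpos : 0 < c := hpos
  refine ⟨c, hpos, ?_⟩
  simp only [zero_add, zero_mul, Real.exp_zero, mul_one, hr.2, smul_eq_mul] at hc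
  rw [inv_mul_lt_iff₀ hpos, mul_zero] at hc
  linarith

/-- An event implied by negativity of a random walk with negative drift has probability
tending to one. -/
lemma tendsto_sum_prod_of_sum_neg {X : Type*} [Fintype X] {r f : X → ℝ} (hr : IsDist r)
    (hf : ∑ x, r x * f x < 0) (P : ∀ n, (Fin n → X) → Prop) [∀ n, DecidablePred (P n)]
    (hP : ∀ n x, ∑ i, f (x i) < 0 → P n x) :
    Tendsto (fun n => ∑ x : Fin n → X, if P n x then ∏ i, r (x i) else 0) atTop (𝓝 1) := by
  obtain ⟨c, hc, hlt⟩ := exists_sum_mul_exp_lt_one hr hf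
  have hprod : ∀ n (x : Fin n → X), 0 ≤ ∏ i, r (x i) := fun n x =>
    Finset.prod_nonneg fun i _ => hr.1 _
  have hsum : ∀ n, ∑ x : Fin n → X, ∏ i, r (x i) = 1 := fun n => by
    rw [← Fintype.sum_pow, hr.2, one_pow]
  have h0 : 0 ≤ ∑ x, r x * Real.exp (c * f x) :=
    Finset.sum_nonneg fun x _ => mul_nonneg (hr.1 x) (Real.exp_pos _).le
  have hlim : Tendsto (fun n : ℕ => 1 - (∑ x, r x * Real.exp (c * f x)) ^ n) atTop (𝓝 1) := by
    simpa using (tendsto_pow_atTop_nhds_zero_of_lt_one h0 hlt).const_sub 1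
  refine tendsto_of_tendsto_of_tendsto_of_le_of_le hlim tendsto_const_nhds (fun n => ?_)
    fun n => ?_
  · dsimp only
    rw [Fintype.sum_pow, ← hsum n, ← Finset.sum_sub_distrib]
    refine Finset.sum_le_sum fun x _ => ?_
    rw [Finset.prod_mul_distrib, ← Real.exp_sum, ← Finset.mul_sum]
    split_ifs with h
    · have := mul_nonneg (hprod n x) (Real.exp_pos (c * ∑ i, f (x i))).le
      linarith
    · have hS : 0 ≤ ∑ i, f (x i) := not_lt.mp fun h' => h (hP n x h')
      have := mul_le_mul_of_nonneg_left (Real.one_le_exp (mul_nonneg hc.le hS)) (hprod n x)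
      linarith
  · dsimp only
    rw [← hsum n]
    refine Finset.sum_le_sum fun x _ => ?_
    split_ifs
    · exact le_rfl
    · exact hprod n x

lemma tendsto_probSge {r a b : Fin 3 → ℝ} (hr : IsDist r)
    (h : 0 < ∑ x, r x * Real.log (a x / b x)) : Tendsto (probSge r a b) atTop (𝓝 1) := by
  refine tendsto_sum_prod_of_sum_neg (f := fun x => -Real.log (a x / b x)) hr ?_ _
    fun n x hx => ?_
  · simpa using h
  · simp only [Finset.sum_neg_distrib] at hx
    exact (neg_neg_iff_pos.mp hx).le

lemma tendsto_probSlt {r a b : Fin 3 → ℝ} (hr : IsDist r)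
    (h : ∑ x, r x * Real.log (a x / b x) < 0) : Tendsto (probSlt r a b) atTop (𝓝 1) :=
  tendsto_sum_prod_of_sum_neg hr h _ fun _ _ hx => hx

lemma exists_mul_lt_rpow_pow (k : ℕ) {t : ℝ} (hk : k * t < 1) :
    ∃ ε₀ : ℝ, 0 < ε₀ ∧ ∀ ε : ℝ, 0 < ε → ε < ε₀ → 10000 * ε < (ε ^ t) ^ k := by
  refine ⟨(1 / 10000) ^ (1 - k * t)⁻¹, by positivity, fun ε hε hlt => ?_⟩
  have h1 : ε ^ (1 - k * t) < 1 / 10000 :=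
    (Real.lt_rpow_inv_iff_of_pos hε.le (by norm_num) (by linarith)).mp hlt
  have h2 : ε = ε ^ (1 - k * t) * (ε ^ t) ^ k := by
    rw [← Real.rpow_mul_natCast hε.le, ← Real.rpow_add hε]
    rw [show 1 - k * t + t * k = 1 by ring, Real.rpow_one]
  have h3 : 0 < (ε ^ t) ^ k := by positivity
  nlinarith

lemma sub_sq_le_log_one_add {u : ℝ} (hu : 0 ≤ u) : u - u ^ 2 ≤ Real.log (1 + u) := by
  refine le_trans ?_ (Real.one_sub_inv_le_log_of_pos (by linarith))
  rw [show 1 - (1 + u)⁻¹ = u / (1 + u) by field_simp; ring, le_div_iff₀ (by linarith)]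
  nlinarith [pow_nonneg hu 3]

lemma neg_sub_two_mul_sq_le_log_one_sub {u : ℝ} (hu : u ≤ 1 / 2) :
    -u - 2 * u ^ 2 ≤ Real.log (1 - u) := by
  refine le_trans ?_ (Real.one_sub_inv_le_log_of_pos (by linarith))
  rw [show 1 - (1 - u)⁻¹ = -u / (1 - u) by field_simp [show (1 - u) ≠ 0 by linarith]; ring,
    le_div_iff₀ (by linarith)]
  nlinarith [mul_nonneg (sq_nonneg u) (by linarith : 0 ≤ 1 - 2 * u)]

lemma add_cube_le_log_div {x : ℝ} (h0 : 0 ≤ x) (h1 : x < 1) :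
    2 * x + 2 / 3 * x ^ 3 ≤ Real.log ((1 + x) / (1 - x)) := by
  have := Real.sum_range_le_log_div h0 h1 2
  norm_num [Finset.sum_range_succ] at this
  linarith

lemma add_sq_le_neg_log_one_sub {x : ℝ} (h0 : 0 ≤ x) (h1 : x < 1) :
    x + x ^ 2 / 2 ≤ -Real.log (1 - x) := by
  have h := Real.hasSum_pow_div_log_of_abs_lt_one (abs_lt.mpr ⟨by linarith, h1⟩)
  have := sum_le_hasSum (Finset.range 2) (fun i _ => by positivity) h
  norm_num [Finset.sum_range_succ] at this
  linarith

lemma tv_drift_pos {ε η : ℝ} (hε : 0 < ε) (hε' : ε < 1 / 40) (hη : 0 < η) (hη1 : η < 1)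
    (h : 10000 * ε < η ^ 3) :
    0 < (1 / 2 - ε) * Real.log ((1 / 2 - 9 * ε - ε * η) / (1 / 2 - ε + ε * η))
      + 1 / 2 * Real.log ((1 / 2 + 8 * ε) / (1 / 2))
      + ε * Real.log ((ε + ε * η) / (ε - ε * η)) := by
  have hδ : 0 < ε * η := mul_pos hε hη
  have hδ' : ε * η < ε := by nlinarith
  have e2 : (1 / 2 + 8 * ε) / (1 / 2) = 1 + 16 * ε := by ring
  have e3 : (ε + ε * η) / (ε - ε * η) = (1 + η) / (1 - η) := by
    rw [show ε + ε * η = ε * (1 + η) by ring, show ε - ε * η = ε * (1 - η) by ring,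
      mul_div_mul_left _ _ hε.ne']
  rw [e2, e3]
  have l2 := sub_sq_le_log_one_add (u := 16 * ε) (by linarith)
  have l3 := mul_le_mul_of_nonneg_left (add_cube_le_log_div hη.le hη1) hε.le
  have hd : 1 / 4 < 1 / 2 - 9 * ε - ε * η := by linarith
  have l1 : -(8 * ε + 2 * (ε * η)) - 360 * ε ^ 2 ≤
      (1 / 2 - ε) * Real.log ((1 / 2 - 9 * ε - ε * η) / (1 / 2 - ε + ε * η)) := by
    refine le_trans ?_ (mul_le_mul_of_nonneg_left (Real.one_sub_inv_le_log_of_pos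
      (div_pos (by linarith) (by linarith))) (by linarith))
    rw [inv_div, show (1 / 2 - ε) * (1 - (1 / 2 - ε + ε * η) / (1 / 2 - 9 * ε - ε * η))
      = -(8 * ε + 2 * (ε * η)) - (8 * ε + 2 * (ε * η)) * (8 * ε + ε * η)
        / (1 / 2 - 9 * ε - ε * η) by
        have hD : 1 / 2 - 9 * ε - ε * η ≠ 0 := by linarith
        generalize hDe : 1 / 2 - 9 * ε - ε * η = D at hD
        rw [show 1 / 2 - ε = D + 8 * ε + ε * η by linarith]
        field_simp
        ring]
    have : (8 * ε + 2 * (ε * η)) * (8 * ε + ε * η) / (1 / 2 - 9 * ε - ε * η)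
        ≤ 360 * ε ^ 2 := by
      rw [div_le_iff₀ (by linarith)]
      nlinarith [mul_le_mul (by linarith : 8 * ε + 2 * (ε * η) ≤ 10 * ε)
        (by linarith : 8 * ε + ε * η ≤ 9 * ε) (by linarith) (by linarith)]
    linarith
  have := mul_lt_mul_of_pos_left h hε
  nlinarith

lemma huber_drift_pos {ε w : ℝ} (hε : 0 < ε) (hε' : ε < 1 / 40) (hw : 0 < w) (hw1 : w < 1)
    (h : 600 * ε < (1 - w) ^ 2) :
    0 < 1 / 2 * Real.log (1 - 20 * ε + 4 * ε * w) + 1 / 2 * Real.log (1 + 16 * ε)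
      + 2 * ε * -Real.log w := by
  have hεw : 0 < ε * w := mul_pos hε hw
  have hεw' : ε * w < ε := by nlinarith
  have l1 := neg_sub_two_mul_sq_le_log_one_sub (u := 20 * ε - 4 * ε * w) (by linarith)
  have l2 := sub_sq_le_log_one_add (u := 16 * ε) (by linarith)
  have l3 := mul_le_mul_of_nonneg_left
    (add_sq_le_neg_log_one_sub (x := 1 - w) (by linarith) (by linarith)) hε.le
  rw [sub_sub_cancel] at l3
  rw [show 1 - (20 * ε - 4 * ε * w) = 1 - 20 * ε + 4 * ε * w by ring] at l1
  have hsq : (20 * ε - 4 * ε * w) ^ 2 ≤ (20 * ε) ^ 2 :=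
    pow_le_pow_left₀ (by linarith) (by linarith) 2
  have := mul_lt_mul_of_pos_left h hε
  nlinarith

lemma subtractive_drift_neg {ε η e : ℝ} (hε : 0 < ε) (hε' : ε < 1 / 40) (hη : 0 < η)
    (h : 10000 * ε < η) (he : 0 ≤ e) (hle : e ≤ 2 * ε + 5 * ε ^ 2 - ε * η) :
    (1 / 2 - 10 * ε) * Real.log ((1 + e) * (1 - 20 * ε) / (1 - e))
      + (1 / 2 + 8 * ε) * Real.log (1 + 16 * ε) < 0 := by
  have hδ : 0 < ε * η := mul_pos hε hη
  have hh := mul_lt_mul_of_pos_left h hε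
  have he3 : e ≤ 3 * ε := by nlinarith
  have l2 : Real.log (1 + 16 * ε) ≤ 16 * ε := by
    linarith [Real.log_le_sub_one_of_pos (by linarith : 0 < 1 + 16 * ε)]
  have l1 : Real.log ((1 + e) * (1 - 20 * ε) / (1 - e))
      ≤ -(16 * ε) + 46 * ε ^ 2 - 2 * (ε * η) := by
    have h1 := Real.log_le_sub_one_of_pos (by linarith : 0 < 1 - 20 * ε)
    have h2 := Real.log_le_sub_one_of_pos
      (div_pos (by linarith : 0 < 1 + e) (by linarith : 0 < 1 - e))
    have h3 : (1 + e) / (1 - e) ≤ 1 + 2 * e + 4 * e ^ 2 := by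
      rw [div_le_iff₀ (by linarith)]
      nlinarith [mul_nonneg (sq_nonneg e) (by linarith : 0 ≤ 1 - 2 * e)]
    rw [show (1 + e) * (1 - 20 * ε) / (1 - e) = (1 + e) / (1 - e) * (1 - 20 * ε) by ring,
      Real.log_mul (div_pos (by linarith) (by linarith)).ne' (by linarith)]
    nlinarith [pow_le_pow_left₀ he he3 2]
  have m1 := mul_le_mul_of_nonneg_left l1 (by linarith : 0 ≤ 1 / 2 - 10 * ε)
  have m2 := mul_le_mul_of_nonneg_left l2 (by linarith : 0 ≤ 1 / 2 + 8 * ε)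
  have m3 : 0 < ε ^ 3 := by positivity
  nlinarith [mul_pos hδ (by linarith : 0 < 1 / 2 - 10 * ε - 1 / 4)]

lemma huber_sum_pos {ε η : ℝ} (hε : 0 < ε) (hε' : ε < 1 / 40) (hη : 0 < η) (hη1 : η < 1)
    (h : 10000 * ε < η ^ 2) :
    0 < (1 - 2 * ε / (1 + 2 * ε)) / 2 *
        Real.log (((1 - (2 * ε / (1 + 2 * ε) - ε * η)) * (1 / 2 - 10 * ε)
          + (2 * ε / (1 + 2 * ε) - ε * η)) / ((1 - (2 * ε / (1 + 2 * ε) - ε * η)) / 2))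
      + (1 - 2 * ε / (1 + 2 * ε)) / 2 *
        Real.log (((1 - (2 * ε / (1 + 2 * ε) - ε * η)) * (1 / 2 + 8 * ε))
          / ((1 - (2 * ε / (1 + 2 * ε) - ε * η)) / 2))
      + 2 * ε / (1 + 2 * ε) *
        Real.log ((2 * ε * (1 - (2 * ε / (1 + 2 * ε) - ε * η)))
          / (2 * ε / (1 + 2 * ε) - ε * η)) := by
  have hδ : 0 < ε * η := mul_pos hε hη
  have hc : 0 < 1 + 2 * ε := by linarith
  have hE : 2 * ε / (1 + 2 * ε) * (1 + 2 * ε) = 2 * ε := div_mul_cancel₀ _ hc.ne'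
  have he : 1 - 2 * ε / (1 + 2 * ε) = 1 / (1 + 2 * ε) := by field_simp; ring
  have he' : 2 * ε / (1 + 2 * ε) = 2 * ε * (1 / (1 + 2 * ε)) := by ring
  have hεη : ε * η < ε := by nlinarith
  have hEpos : 0 < 2 * ε / (1 + 2 * ε) - ε * η := by nlinarith
  have hElt : 2 * ε / (1 + 2 * ε) - ε * η ≤ 2 * ε - ε * η := by nlinarith
  have hw2 : 2 * ε / (1 + 2 * ε) - ε * η
      ≤ (1 - η / 2) * (2 * ε * (1 - (2 * ε / (1 + 2 * ε) - ε * η))) := by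
    have h1 : 1 - (2 * ε / (1 + 2 * ε) - ε * η) = 1 / (1 + 2 * ε) + ε * η := by linarith
    have h2 : 1 / (1 + 2 * ε) ≤ 1 := (div_le_one hc).mpr (by linarith)
    rw [h1, he']
    nlinarith [mul_nonneg hδ.le (sub_nonneg.mpr h2),
      mul_nonneg (mul_pos hδ hε).le (by linarith : 0 ≤ 1 - η / 2)]
  generalize hs : 1 - (2 * ε / (1 + 2 * ε) - ε * η) = s at *
  generalize 2 * ε / (1 + 2 * ε) - ε * η = e at *
  have hs0 : 0 < s := by linarith
  have hw0 : 0 < e / (2 * ε * s) := by positivity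
  have hw : e / (2 * ε * s) ≤ 1 - η / 2 := (div_le_iff₀ (by positivity)).mpr hw2
  have hsq := pow_le_pow_left₀ (by linarith : 0 ≤ η / 2)
    (by linarith : η / 2 ≤ 1 - e / (2 * ε * s)) 2
  have key := huber_drift_pos hε hε' hw0 (by linarith) (by linarith)
  have e1 : (s * (1 / 2 - 10 * ε) + e) / (s / 2)
      = 1 - 20 * ε + 4 * ε * (e / (2 * ε * s)) := by field_simp; ring
  have e2 : s * (1 / 2 + 8 * ε) / (s / 2) = 1 + 16 * ε := by field_simp; ring
  rw [← Real.log_inv, inv_div] at key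
  rw [e1, e2, he, he']
  have := mul_pos (one_div_pos.mpr hc) key
  linarith

lemma subtractive_sum_neg {ε η : ℝ} (hε : 0 < ε) (hε' : ε < 1 / 40) (hη : 0 < η) (hη1 : η < 1)
    (h : 10000 * ε < η) :
    (1 + 2 * ε / (1 - 2 * ε)) * (1 / 2 - 10 * ε) *
        Real.log ((1 + (2 * ε / (1 - 2 * ε) - ε * η)) * (1 / 2 - 10 * ε)
          / ((1 - (2 * ε / (1 - 2 * ε) - ε * η)) / 2))
      + (1 + 2 * ε / (1 - 2 * ε)) * (1 / 2 + 8 * ε) *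
        Real.log ((1 + (2 * ε / (1 - 2 * ε) - ε * η)) * (1 / 2 + 8 * ε)
          / ((1 + (2 * ε / (1 - 2 * ε) - ε * η)) / 2))
      + 0 * Real.log ((2 * ε * (1 + (2 * ε / (1 - 2 * ε) - ε * η))
          - (2 * ε / (1 - 2 * ε) - ε * η)) / 0) < 0 := by
  have hc : 0 < 1 - 2 * ε := by linarith
  have hε2 : 2 * ε ≤ 2 * ε / (1 - 2 * ε) := by
    rw [le_div_iff₀ hc]; nlinarith
  have hε2' : 2 * ε / (1 - 2 * ε) ≤ 2 * ε + 5 * ε ^ 2 := by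
    rw [div_le_iff₀ hc]; nlinarith [mul_pos hε hε]
  have hεη : ε * η < ε := by nlinarith
  generalize 2 * ε / (1 - 2 * ε) = e at *
  have key := subtractive_drift_neg hε hε' hη h (e := e - ε * η) (by linarith) (by linarith)
  have hs : 0 < 1 + (e - ε * η) := by linarith
  have e2 : (1 + (e - ε * η)) * (1 / 2 + 8 * ε) / ((1 + (e - ε * η)) / 2) = 1 + 16 * ε := by
    generalize 1 + (e - ε * η) = s at *
    field_simp; ring
  have e1 : (1 + (e - ε * η)) * (1 / 2 - 10 * ε) / ((1 - (e - ε * η)) / 2)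
      = (1 + (e - ε * η)) * (1 - 20 * ε) / (1 - (e - ε * η)) := by
    generalize 1 - (e - ε * η) = s
    rw [div_div_eq_mul_div]; ring
  rw [e1, e2, zero_mul, add_zero, mul_assoc, mul_assoc, ← mul_add]
  exact mul_neg_of_pos_of_neg (by linarith) key

/-- Breakdown of the likelihood ratio test calibrated to an underestimated contamination
level, in the TV, Huber and subtractive models, for the three-point example. -/
theorem breakdown_under_underestimated_contamination :
    -- (i) TV contamination
    (∀ t : ℝ, 0 < t → t < 1 / 3 →
      ∃ ε₀ : ℝ, 0 < ε₀ ∧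
        ∀ ε : ℝ, 0 < ε → ε < ε₀ → ε < 1 / 40 →
          (![1 / 2 - ε, 1 / 2, ε] ∈ PTV qEx ε) ∧
          Filter.Tendsto
            (probSge ![1 / 2 - ε, 1 / 2, ε]
              ![1 / 2 - 9 * ε - ε ^ (1 + t), 1 / 2 + 8 * ε, ε + ε ^ (1 + t)]
              ![1 / 2 - ε + ε ^ (1 + t), 1 / 2, ε - ε ^ (1 + t)])
            Filter.atTop (nhds 1)) ∧
    -- (ii) Huber contamination
    (∀ t : ℝ, 0 < t → t < 1 / 2 →
      ∃ ε₀ : ℝ, 0 < ε₀ ∧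
        ∀ ε : ℝ, 0 < ε → ε < ε₀ → ε < 1 / 40 →
          (![(1 - 2 * ε / (1 + 2 * ε)) / 2, (1 - 2 * ε / (1 + 2 * ε)) / 2,
              2 * ε / (1 + 2 * ε)] ∈ PHub qEx (2 * ε / (1 + 2 * ε))) ∧
          Filter.Tendsto
            (probSge
              ![(1 - 2 * ε / (1 + 2 * ε)) / 2, (1 - 2 * ε / (1 + 2 * ε)) / 2,
                2 * ε / (1 + 2 * ε)]
              ![(1 - (2 * ε / (1 + 2 * ε) - ε ^ (1 + t))) * (1 / 2 - 10 * ε)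
                  + (2 * ε / (1 + 2 * ε) - ε ^ (1 + t)),
                (1 - (2 * ε / (1 + 2 * ε) - ε ^ (1 + t))) * (1 / 2 + 8 * ε),
                2 * ε * (1 - (2 * ε / (1 + 2 * ε) - ε ^ (1 + t)))]
              ![(1 - (2 * ε / (1 + 2 * ε) - ε ^ (1 + t))) / 2,
                (1 - (2 * ε / (1 + 2 * ε) - ε ^ (1 + t))) / 2,
                2 * ε / (1 + 2 * ε) - ε ^ (1 + t)])
            Filter.atTop (nhds 1)) ∧
    -- (iii) subtractive contamination
    (∀ t : ℝ, 0 < t → t < 1 →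
      ∃ ε₀ : ℝ, 0 < ε₀ ∧
        ∀ ε : ℝ, 0 < ε → ε < ε₀ → ε < 1 / 40 →
          (![(1 + 2 * ε / (1 - 2 * ε)) * (1 / 2 - 10 * ε),
              (1 + 2 * ε / (1 - 2 * ε)) * (1 / 2 + 8 * ε), 0]
            ∈ PSub (pEx ε) (2 * ε / (1 - 2 * ε))) ∧
          Filter.Tendsto
            (probSlt
              ![(1 + 2 * ε / (1 - 2 * ε)) * (1 / 2 - 10 * ε),
                (1 + 2 * ε / (1 - 2 * ε)) * (1 / 2 + 8 * ε), 0]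
              ![(1 + (2 * ε / (1 - 2 * ε) - ε ^ (1 + t))) * (1 / 2 - 10 * ε),
                (1 + (2 * ε / (1 - 2 * ε) - ε ^ (1 + t))) * (1 / 2 + 8 * ε),
                2 * ε * (1 + (2 * ε / (1 - 2 * ε) - ε ^ (1 + t)))
                  - (2 * ε / (1 - 2 * ε) - ε ^ (1 + t))]
              ![(1 - (2 * ε / (1 - 2 * ε) - ε ^ (1 + t))) / 2,
                (1 + (2 * ε / (1 - 2 * ε) - ε ^ (1 + t))) / 2, 0])
            Filter.atTop (nhds 1)) := by
  refine ⟨fun t ht0 ht => ?_, fun t ht0 ht => ?_, fun t ht0 ht => ?_⟩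
  · obtain ⟨ε₀, h0, H⟩ := exists_mul_lt_rpow_pow 3 (t := t) (by push_cast; linarith)
    refine ⟨ε₀, h0, fun ε hε hlt hε' => ?_⟩
    have hη : 0 < ε ^ t := Real.rpow_pos_of_pos hε t
    have hη1 : ε ^ t < 1 := Real.rpow_lt_one hε.le (by linarith) ht0
    have hδ : ε ^ (1 + t) = ε * ε ^ t := by rw [Real.rpow_add hε, Real.rpow_one]
    have hr : IsDist ![1 / 2 - ε, 1 / 2, ε] := by
      refine ⟨fun x => ?_, ?_⟩
      · fin_cases x
        · show 0 ≤ 1 / 2 - ε; linarith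
        · show (0 : ℝ) ≤ 1 / 2; norm_num
        · exact hε.le
      · rw [Fin.sum_univ_three]
        show 1 / 2 - ε + 1 / 2 + ε = 1
        ring
    refine ⟨⟨hr, ?_⟩, tendsto_probSge hr ?_⟩
    · simp [dTV, qEx, Fin.sum_univ_three, abs_of_pos hε]
      linarith
    · rw [hδ, Fin.sum_univ_three]
      exact tv_drift_pos hε hε' hη hη1 (H ε hε hlt)
  · obtain ⟨ε₀, h0, H⟩ := exists_mul_lt_rpow_pow 2 (t := t) (by push_cast; linarith)
    refine ⟨ε₀, h0, fun ε hε hlt hε' => ?_⟩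
    have hη : 0 < ε ^ t := Real.rpow_pos_of_pos hε t
    have hη1 : ε ^ t < 1 := Real.rpow_lt_one hε.le (by linarith) ht0
    have hδ : ε ^ (1 + t) = ε * ε ^ t := by rw [Real.rpow_add hε, Real.rpow_one]
    have hH := H ε hε hlt
    have he : 1 - 2 * ε / (1 + 2 * ε) = 1 / (1 + 2 * ε) := by field_simp; ring
    have he0 : 0 < 1 - 2 * ε / (1 + 2 * ε) := by rw [he]; positivity
    have hr : IsDist ![(1 - 2 * ε / (1 + 2 * ε)) / 2, (1 - 2 * ε / (1 + 2 * ε)) / 2,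
        2 * ε / (1 + 2 * ε)] := by
      refine ⟨fun x => ?_, ?_⟩
      · fin_cases x
        · exact (half_pos he0).le
        · exact (half_pos he0).le
        · show 0 ≤ 2 * ε / (1 + 2 * ε); positivity
      · simp [Fin.sum_univ_three]
    refine ⟨⟨hr, fun x => ?_⟩, tendsto_probSge hr ?_⟩
    · fin_cases x
      · show _ * (1 / 2) ≤ _ / 2; linarith
      · show _ * (1 / 2) ≤ _ / 2; linarith
      · show _ * 0 ≤ 2 * ε / (1 + 2 * ε); rw [mul_zero]; positivity
    · rw [hδ, Fin.sum_univ_three]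
      exact huber_sum_pos hε hε' hη hη1 hH
  · obtain ⟨ε₀, h0, H⟩ := exists_mul_lt_rpow_pow 1 (t := t) (by push_cast; linarith)
    refine ⟨ε₀, h0, fun ε hε hlt hε' => ?_⟩
    have hη : 0 < ε ^ t := Real.rpow_pos_of_pos hε t
    have hη1 : ε ^ t < 1 := Real.rpow_lt_one hε.le (by linarith) ht0
    have hδ : ε ^ (1 + t) = ε * ε ^ t := by rw [Real.rpow_add hε, Real.rpow_one]
    have hH := H ε hε hlt
    rw [pow_one] at hH
    have hd : 0 < 1 - 2 * ε := by linarith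
    have he : 1 + 2 * ε / (1 - 2 * ε) = 1 / (1 - 2 * ε) := by
      field_simp [hd.ne']; ring
    have he0 : 0 < 1 + 2 * ε / (1 - 2 * ε) := by rw [he]; positivity
    have hr : IsDist ![(1 + 2 * ε / (1 - 2 * ε)) * (1 / 2 - 10 * ε),
        (1 + 2 * ε / (1 - 2 * ε)) * (1 / 2 + 8 * ε), 0] := by
      refine ⟨fun x => ?_, ?_⟩
      · fin_cases x
        · exact mul_nonneg he0.le (by linarith)
        · exact mul_nonneg he0.le (by linarith)
        · exact le_rfl
      · rw [Fin.sum_univ_three, he]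
        show 1 / (1 - 2 * ε) * (1 / 2 - 10 * ε) + 1 / (1 - 2 * ε) * (1 / 2 + 8 * ε) + 0 = 1
        field_simp [hd.ne']
        ring
    refine ⟨⟨hr, fun x => ?_⟩, tendsto_probSlt hr ?_⟩
    · fin_cases x
      · exact le_rfl
      · exact le_rfl
      · exact mul_nonneg he0.le (by show 0 ≤ 2 * ε; linarith)
    · rw [hδ, Fin.sum_univ_three]
      exact subtractive_sum_neg hε hε' hη hη1 hH

end
end
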